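/- Under the stated assumptions on q, ε and w, and if ‖w(0,·)‖_{L²(0,∞)} ≤ 1, there are numerical constants C, C₁ > 0 (independent of ε, q and w) such that for every t ∈ [0,1], the component of W_t orthogonal to ψ₁^{q(t)} satisfies ‖W_t − ⟨W_t, ψ₁^{q(t)}⟩·ψ₁^{q(t)}‖_{L²(0,∞)} ≤ C·((Q₂+1)/Q₁)·ε·( ((Q₂+1)/Q₁)·ε + |⟨W_0, ψ₁^{q(0)}⟩| ) + exp(−C₁·ε^{-1}·Q₁·t), where W_t(x) = exp(ε^{-1}·α₁·∫₀^t q(s)^{2/3} ds)·w(t,x), Q₁ = inf_{t∈[0,1]} q(t)^{2/3} and Q₂ = sup_{t∈[0,1]} |q'(t)/q(t)|. -/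

import Mathlib

open MeasureTheory Filter Set

/-- The Airy function of the first kind, defined as
`Ai(x) = (1/π) · lim_{R→∞} ∫₀^R cos(t³/3 + x·t) dt`. -/
noncomputable def Ai (x : ℝ) : ℝ :=
  (1 / Real.pi) *
    limUnder Filter.atTop (fun R : ℝ => ∫ t in (0:ℝ)..R, Real.cos (t ^ 3 / 3 + x * t))

/-- The renormalized solution `W_t(x) = exp(ε⁻¹·α₁·∫₀^t q(s)^{2/3} ds)·w(t,x)`. -/
noncomputable def Wfun (α₁ ε : ℝ) (q : ℝ → ℝ) (w : ℝ → ℝ → ℝ) (t x : ℝ) : ℝ :=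
  Real.exp (ε⁻¹ * α₁ * ∫ s in (0:ℝ)..t, q s ^ ((2:ℝ)/3)) * w t x

/-- The `L²(0,∞)`-normalized principal eigenfunction
`ψ₁^q(x) = q^{1/6}·Ai(q^{1/3}x − α₁)/|Ai'(−α₁)|` of `u ↦ u'' − q·x·u`. -/
noncomputable def psiOne (α₁ q x : ℝ) : ℝ :=
  q ^ ((1:ℝ)/6) * Ai (q ^ ((1:ℝ)/3) * x - α₁) / |deriv Ai (-α₁)|

/-- `Q₁ = inf_{t∈[0,1]} q(t)^{2/3}`. -/
noncomputable def Qone (q : ℝ → ℝ) : ℝ :=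
  sInf ((fun t => q t ^ ((2:ℝ)/3)) '' Set.Icc (0:ℝ) 1)

/-- `Q₂ = sup_{t∈[0,1]} |(log q)'(t)| = sup_{t∈[0,1]} |q'(t)/q(t)|`. -/
noncomputable def Qtwo (q : ℝ → ℝ) : ℝ :=
  sSup ((fun t => |deriv q t / q t|) '' Set.Icc (0:ℝ) 1)

open Topology

noncomputable def aK (x s : ℝ) : ℂ :=
  Complex.exp (-(2 + 2 * Complex.I) / 3 * (s:ℂ) ^ 3 + (Complex.I - 1) * (x:ℂ) * (s:ℂ))

lemma norm_aK (x s : ℝ) : ‖aK x s‖ = Real.exp (-(2/3) * s ^ 3 - x * s) := by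
  rw [aK, Complex.norm_exp]
  congr 1
  have h : (s:ℂ)^3 = ((s^3 : ℝ) : ℂ) := by push_cast; rfl
  rw [h]
  simp [-Complex.ofReal_pow]
  ring

lemma integrableOn_aK_bound (n : ℕ) (M : ℝ) :
    IntegrableOn (fun s : ℝ => s ^ n * Real.exp (-(2/3) * s ^ 3 + M * s)) (Ioi 0) := by
  refine integrable_of_isBigO_exp_neg (b := 1) one_pos (by fun_prop) ?_
  have h1 : (fun s : ℝ => s ^ n) =O[atTop] fun s => Real.exp (1 * s) :=
    (isLittleO_pow_exp_pos_mul_atTop (k := n) one_pos).isBigO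
  have h2 : (fun s : ℝ => Real.exp (-(2/3) * s ^ 3 + M * s)) =O[atTop]
      fun s => Real.exp (-2 * s) := by
    refine Asymptotics.IsBigO.of_bound 1 ?_
    filter_upwards [eventually_ge_atTop (|M| + 3)] with s hs
    rw [Real.norm_of_nonneg (Real.exp_nonneg _), Real.norm_of_nonneg (Real.exp_nonneg _), one_mul,
      Real.exp_le_exp]
    have hM := le_abs_self M
    have hM0 := abs_nonneg M
    have h3 : s * (M + 2 - 2/3 * s ^ 2) ≤ 0 := by
      apply mul_nonpos_of_nonneg_of_nonpos (by linarith)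
      nlinarith
    nlinarith
  have := h1.mul h2
  refine this.congr_right ?_
  intro s
  rw [← Real.exp_add]
  congr 1; ring

lemma continuous_aK (x : ℝ) : Continuous (aK x) := by
  unfold aK; fun_prop

noncomputable def aG (n : ℕ) (x : ℝ) : ℂ := ∫ s in Ioi (0:ℝ), (s:ℂ) ^ n * aK x s

lemma integrableOn_aK (n : ℕ) (x : ℝ) :
    IntegrableOn (fun s : ℝ => (s:ℂ) ^ n * aK x s) (Ioi 0) := by
  refine Integrable.mono' (integrableOn_aK_bound n (-x)) ?_ ?_
  · exact (Continuous.aestronglyMeasurable (by have := continuous_aK x; fun_prop))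
  · refine (ae_restrict_iff' measurableSet_Ioi).2 (Eventually.of_forall fun s hs => ?_)
    have hs : 0 < s := hs
    rw [norm_mul, norm_aK, norm_pow, Complex.norm_real, Real.norm_of_nonneg hs.le]
    rw [sub_eq_add_neg, neg_mul x s]

lemma hasDerivAt_aG (n : ℕ) (x : ℝ) :
    HasDerivAt (aG n) ((Complex.I - 1) * aG (n+1) x) x := by
  have key := hasDerivAt_integral_of_dominated_loc_of_deriv_le (𝕜 := ℝ)
    (μ := volume.restrict (Ioi (0:ℝ))) (x₀ := x) (s := Metric.ball x 1)
    (F := fun x s => (s:ℂ) ^ n * aK x s)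
    (F' := fun x s => (Complex.I - 1) * ((s:ℂ) ^ (n+1) * aK x s))
    (bound := fun s => 2 * (s ^ (n+1) * Real.exp (-(2/3) * s ^ 3 + (1 - x) * s)))
    (Metric.ball_mem_nhds x one_pos)
    (Eventually.of_forall fun y => (integrableOn_aK n y).aestronglyMeasurable)
    (integrableOn_aK n x)
    ((integrableOn_aK (n+1) x).const_mul _).aestronglyMeasurable
    ?_ ((integrableOn_aK_bound (n+1) (1-x)).const_mul 2) ?_
  · have := key.2
    rw [integral_const_mul] at this
    exact this
  · refine (ae_restrict_iff' measurableSet_Ioi).2 (Eventually.of_forall fun s hs y hy => ?_)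
    have hs : 0 < s := hs
    rw [norm_mul, norm_mul, norm_aK, norm_pow, Complex.norm_real, Real.norm_of_nonneg hs.le]
    have h2 : ‖Complex.I - 1‖ ≤ 2 := by
      refine (norm_sub_le _ _).trans ?_
      simp; norm_num
    rw [Metric.mem_ball, Real.dist_eq, abs_lt] at hy
    gcongr
    nlinarith
  · refine Eventually.of_forall fun s y _ => ?_
    have h1 : HasDerivAt (fun y : ℝ => -(2 + 2 * Complex.I) / 3 * (s:ℂ) ^ 3 +
        (Complex.I - 1) * (y:ℂ) * (s:ℂ)) ((Complex.I - 1) * (s:ℂ)) y := by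
      have h0 : HasDerivAt (fun y : ℝ => (y:ℂ)) 1 y := Complex.ofRealCLM.hasDerivAt
      have := ((h0.const_mul (Complex.I - 1)).mul_const (s:ℂ)).const_add
        (-(2 + 2 * Complex.I) / 3 * (s:ℂ) ^ 3)
      convert! this using 1
      ring
    have h2 := (h1.cexp).const_mul ((s:ℂ)^n)
    convert! h2 using 1
    simp only [aK]
    ring

lemma aK_tendsto (x : ℝ) : Tendsto (aK x) atTop (𝓝 0) := by
  rw [tendsto_zero_iff_norm_tendsto_zero]
  simp only [norm_aK]
  refine Real.tendsto_exp_atBot.comp ?_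
  refine tendsto_atBot_mono' (f₁ := fun s : ℝ => - s) _ ?_ tendsto_neg_atTop_atBot
  filter_upwards [eventually_ge_atTop (|x| + 3)] with s hs
  have hM := neg_abs_le x
  have hM0 := abs_nonneg x
  have h3 : s * (-x + 1 - 2/3 * s ^ 2) ≤ 0 := by
    apply mul_nonpos_of_nonneg_of_nonpos (by linarith)
    nlinarith
  nlinarith

lemma aG_ibp (x : ℝ) :
    -(2 + 2 * Complex.I) * aG 2 x + (Complex.I - 1) * x * aG 0 x = -1 := by
  have h := integral_Ioi_of_hasDerivAt_of_tendsto' (a := (0:ℝ)) (f := aK x) (m := 0)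
    (f' := fun s => -(2 + 2 * Complex.I) * ((s:ℂ)^2 * aK x s) +
      (Complex.I - 1) * x * ((s:ℂ)^0 * aK x s)) ?_ ?_ (aK_tendsto x)
  · rw [integral_add, integral_const_mul, integral_const_mul] at h
    · have h0 : aK x 0 = 1 := by simp [aK]
      rw [h0] at h
      simpa [aG] using h
    · exact (integrableOn_aK 2 x).const_mul _
    · exact (integrableOn_aK 0 x).const_mul _
  · intro s _
    have h0 : HasDerivAt (fun y : ℝ => (y:ℂ)) 1 s := Complex.ofRealCLM.hasDerivAt
    have h1 := (((h0.pow 3).const_mul (-(2 + 2 * Complex.I) / 3)).add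
      (h0.const_mul ((Complex.I - 1) * (x:ℂ)))).cexp
    convert! h1 using 1
    simp only [aK, Pi.add_apply, Pi.pow_apply]
    push_cast
    ring
  · exact ((integrableOn_aK 2 x).const_mul _).add ((integrableOn_aK 0 x).const_mul _)

lemma airy_vertical (x : ℝ) : Tendsto (fun R : ℝ => ∫ y in (0:ℝ)..R,
    Complex.I * Complex.exp (Complex.I * (((R:ℂ) + y * Complex.I)^3 / 3 + x * (R + y * Complex.I))))
    atTop (𝓝 0) := by
  have hb : ∀ᶠ R : ℝ in atTop, ‖∫ y in (0:ℝ)..R,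
    Complex.I * Complex.exp (Complex.I * (((R:ℂ) + y * Complex.I)^3 / 3 + x * (R + y * Complex.I)))‖
      ≤ R⁻¹ := by
    filter_upwards [eventually_ge_atTop (|x| + 3)] with R hR
    have hM := neg_abs_le x
    have hM0 := abs_nonneg x
    have hR0 : 0 < R := by linarith
    have h1 : ∀ y ∈ Ioc (0:ℝ) R, ‖Complex.I * Complex.exp (Complex.I *
        (((R:ℂ) + y * Complex.I)^3 / 3 + x * (R + y * Complex.I)))‖ ≤ Real.exp (-R * y) := by
      intro y hy
      rw [norm_mul, Complex.norm_I, one_mul, Complex.norm_exp, Real.exp_le_exp]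
      have e : Complex.I * (((R:ℂ) + y * Complex.I)^3 / 3 + x * (R + y * Complex.I)) =
        ((-(R^2*y - y^3/3 + x*y) : ℝ) : ℂ) + ((R^3/3 - R*y^2 + x*R : ℝ):ℂ) * Complex.I := by
        push_cast
        have h2 := Complex.I_sq
        have h3 : Complex.I^3 = - Complex.I := by rw [pow_succ, h2]; ring
        have h4 : Complex.I^4 = 1 := by rw [pow_succ, h3]; ring_nf; rw [h2]; ring
        ring_nf
        rw [h2, h3, h4]; ring
      rw [e]
      simp only [Complex.add_re, Complex.ofReal_re, Complex.re_ofReal_mul, Complex.I_re, mul_zero,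
        add_zero]
      have hy0 := hy.1
      have hyR := hy.2
      have h5 : y^2 ≤ R^2 := by nlinarith
      have h6 : 0 ≤ y * (R^2 - y^2/3 + x - R) := by
        apply mul_nonneg hy0.le
        nlinarith
      nlinarith
    have h2 := intervalIntegral.norm_integral_le_of_norm_le (μ := volume) hR0.le
      (Eventually.of_forall h1) (by apply Continuous.intervalIntegrable; fun_prop)
    refine h2.trans ?_
    have h3 : ∫ y in (0:ℝ)..R, Real.exp (-R * y) = (1 - Real.exp (-R*R)) / R := by
      rw [intervalIntegral.integral_eq_sub_of_hasDerivAt (f := fun y => -Real.exp (-R*y)/R)]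
      · simp; ring
      · intro y _
        have := (((((hasDerivAt_id y).const_mul (-R)).exp).neg).div_const R)
        convert! this using 1
        simp; field_simp
      · apply Continuous.intervalIntegrable; fun_prop
    rw [h3, div_eq_mul_inv]
    have := Real.exp_pos (-R*R)
    have : 0 < R⁻¹ := inv_pos.2 hR0
    nlinarith
  exact squeeze_zero_norm' hb tendsto_inv_atTop_zero

lemma Ai_eq (x : ℝ) : Ai x = (1 / Real.pi) * ((1 + Complex.I) * aG 0 x).re := by
  have hd : Differentiable ℂ (fun z : ℂ => Complex.exp (Complex.I * (z^3/3 + x * z))) := by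
    fun_prop
  obtain ⟨P, hP⟩ := hd.isExactOn_univ
  have hP' := fun z => hP z (mem_univ z)
  have e1 : ∀ R : ℝ, ∫ t in (0:ℝ)..R, Complex.exp (Complex.I * ((t:ℂ)^3/3 + x * t)) = P R - P 0 := by
    intro R
    rw [intervalIntegral.integral_eq_sub_of_hasDerivAt (f := fun t : ℝ => P t)]
    · simp
    · intro t _
      exact (hP' t).comp_ofReal
    · apply Continuous.intervalIntegrable; fun_prop
  have e2 : ∀ R : ℝ, ∫ t in (0:ℝ)..R, (1 + Complex.I) * ((t:ℂ)^0 * aK x t) =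
      P ((1 + Complex.I) * R) - P 0 := by
    intro R
    rw [intervalIntegral.integral_eq_sub_of_hasDerivAt (f := fun t : ℝ => P ((1 + Complex.I) * t))]
    · simp
    · intro t _
      have h0 : HasDerivAt (fun y : ℝ => (1 + Complex.I) * (y:ℂ)) ((1 + Complex.I) * 1) t :=
        (Complex.ofRealCLM.hasDerivAt).const_mul _
      have := HasDerivAt.comp t (hP' ((1 + Complex.I) * t)) h0
      convert! this using 1
      simp only [aK, pow_zero, one_mul, mul_one]
      rw [mul_comm]
      congr 2
      have h2 := Complex.I_sq
      have h3 : Complex.I^3 = - Complex.I := by rw [pow_succ, h2]; ring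
      have h4 : Complex.I^4 = 1 := by rw [pow_succ, h3]; ring_nf; rw [h2]; ring
      ring_nf
      rw [h2, h3, h4]; ring
    · apply Continuous.intervalIntegrable
      have := continuous_aK x
      fun_prop
  have e3 : ∀ R : ℝ, ∫ y in (0:ℝ)..R,
    Complex.I * Complex.exp (Complex.I * (((R:ℂ) + y * Complex.I)^3 / 3 + x * (R + y * Complex.I)))
      = P ((1 + Complex.I) * R) - P R := by
    intro R
    rw [intervalIntegral.integral_eq_sub_of_hasDerivAt (f := fun y : ℝ => P (R + y * Complex.I))]
    · simp; congr 1; ring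
    · intro y _
      have h0 : HasDerivAt (fun y : ℝ => (R:ℂ) + (y:ℂ) * Complex.I) (1 * Complex.I) y :=
        ((Complex.ofRealCLM.hasDerivAt).mul_const _).const_add _
      have := HasDerivAt.comp y (hP' (R + y * Complex.I)) h0
      convert! this using 1
      ring
    · apply Continuous.intervalIntegrable; fun_prop
  have hI : Tendsto (fun R : ℝ => ∫ t in (0:ℝ)..R, (1 + Complex.I) * ((t:ℂ)^0 * aK x t)) atTop
      (𝓝 ((1 + Complex.I) * aG 0 x)) := by
    have := intervalIntegral_tendsto_integral_Ioi (0:ℝ)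
      ((integrableOn_aK 0 x).const_mul (1 + Complex.I)) tendsto_id
    rw [integral_const_mul] at this
    exact this
  have hlim : Tendsto (fun R : ℝ => ∫ t in (0:ℝ)..R, Real.cos (t ^ 3 / 3 + x * t)) atTop
      (𝓝 (((1 + Complex.I) * aG 0 x).re)) := by
    have h1 := hI.sub (airy_vertical x)
    have h2 := (Complex.continuous_re.tendsto _).comp h1
    rw [sub_zero] at h2
    refine h2.congr ?_
    intro R
    simp only [Function.comp]
    rw [e2, e3]
    have : P ((1 + Complex.I) * ↑R) - P 0 - (P ((1 + Complex.I) * ↑R) - P ↑R) = P R - P 0 := by ring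
    rw [this, ← e1]
    have h3 := Complex.reCLM.intervalIntegral_comp_comm (μ := volume) (a := 0) (b := R)
      (f := fun t : ℝ => Complex.exp (Complex.I * ((t:ℂ)^3/3 + x * t)))
      (by apply Continuous.intervalIntegrable; fun_prop)
    simp only [Complex.reCLM_apply] at h3
    rw [← h3]
    apply intervalIntegral.integral_congr
    intro t _
    have e : Complex.I * ((t:ℂ)^3/3 + x * t) = ((t^3/3 + x*t : ℝ):ℂ) * Complex.I := by
      push_cast; ring
    simp only
    rw [e, Complex.exp_ofReal_mul_I_re]
  rw [Ai, hlim.limUnder_eq]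

noncomputable def Ai1 (x : ℝ) : ℝ := (1 / Real.pi) * ((1 + Complex.I) * ((Complex.I - 1) * aG 1 x)).re

lemma hasDerivAt_Ai (x : ℝ) : HasDerivAt Ai (Ai1 x) x := by
  have h1 := ((hasDerivAt_aG 0 x).const_mul (1 + Complex.I))
  have h2 := (Complex.reCLM.hasFDerivAt.comp_hasDerivAt x h1).const_mul (1 / Real.pi)
  have e : Ai = fun x => (1 / Real.pi) * ((1 + Complex.I) * aG 0 x).re := funext Ai_eq
  rw [e]
  exact h2

lemma hasDerivAt_Ai1 (x : ℝ) : HasDerivAt Ai1 (x * Ai x) x := by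
  have h1 := (((hasDerivAt_aG 1 x).const_mul (Complex.I - 1)).const_mul (1 + Complex.I))
  have h2 := (Complex.reCLM.hasFDerivAt.comp_hasDerivAt x h1).const_mul (1 / Real.pi)
  convert! h2 using 1
  rw [Ai_eq]
  have h := aG_ibp x
  have e : (1 + Complex.I) * ((Complex.I - 1) * ((Complex.I - 1) * aG (1+1) x)) =
     (x:ℂ) * ((1 + Complex.I) * aG 0 x) - Complex.I := by
    have hI := Complex.I_sq
    have h' : (2 + 2 * Complex.I) * aG 2 x = 1 + (Complex.I - 1) * x * aG 0 x := by
      linear_combination -h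
    have : (1 + Complex.I) * ((Complex.I - 1) * ((Complex.I - 1) * aG (1+1) x)) =
      - Complex.I * ((2 + 2 * Complex.I) * aG 2 x) := by
      norm_num
      linear_combination (aG 2 x * (Complex.I + 1)) * hI 
    rw [this, h']
    linear_combination (- (x:ℂ) * aG 0 x) * hI
  simp only [Complex.reCLM_apply]
  rw [e]
  simp
  ring

lemma Ai_bdd : ∃ M : ℝ, ∀ x, 0 ≤ x → |Ai x| ≤ M := by
  refine ⟨|1 / Real.pi| * (‖1 + Complex.I‖ * ∫ s in Ioi (0:ℝ), s ^ 0 * Real.exp (-(2/3) * s ^ 3 + 0 * s)),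
    fun x hx => ?_⟩
  rw [Ai_eq, abs_mul]
  gcongr
  refine (Complex.abs_re_le_norm _).trans ?_
  rw [norm_mul]
  gcongr
  rw [aG]
  refine norm_integral_le_of_norm_le (integrableOn_aK_bound 0 0) ?_
  refine (ae_restrict_iff' measurableSet_Ioi).2 (Eventually.of_forall fun s hs => ?_)
  have hs : 0 < s := hs
  rw [norm_mul, norm_aK, norm_pow, Complex.norm_real, Real.norm_of_nonneg hs.le]
  gcongr
  nlinarith

lemma exp_unbdd (c M : ℝ) (hc : 0 < c) (x0 : ℝ) : ∃ x, x0 ≤ x ∧ M < c * Real.exp x := by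
  have h := (Real.tendsto_exp_atTop.const_mul_atTop hc)
  obtain ⟨x, h1, h2⟩ := ((h.eventually_gt_atTop M).and (eventually_ge_atTop x0)).exists
  exact ⟨x, h2, h1⟩

lemma airy_pos_facts (f f1 : ℝ → ℝ) (hf : ∀ x, HasDerivAt f (f1 x) x)
    (hf1 : ∀ x, HasDerivAt f1 (x * f x) x) (hpos : ∀ x, 0 ≤ x → 0 < f x) (M : ℝ)
    (hM : ∀ x, 0 ≤ x → f x ≤ M) :
    (∀ x, 1 ≤ x → f1 x ≤ 0) ∧ (∀ x, 1 ≤ x → f x ≤ f 1 * Real.exp 1 * Real.exp (-x)) ∧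
    (∀ x, 1 ≤ x → - f1 x ≤ (x + 2) * f x) := by
  have cf : Continuous f := continuous_iff_continuousAt.2 fun x => (hf x).continuousAt
  have cf1 : Continuous f1 := continuous_iff_continuousAt.2 fun x => (hf1 x).continuousAt
  have mono1 : MonotoneOn f1 (Ici 0) := by
    apply monotoneOn_of_deriv_nonneg (convex_Ici 0) cf1.continuousOn
      (fun x _ => (hf1 x).differentiableAt.differentiableWithinAt)
    intro x hx
    rw [interior_Ici] at hx
    have hx : 0 < x := hx
    rw [(hf1 x).deriv]
    exact mul_nonneg hx.le (hpos x hx.le).le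
  have neg1 : ∀ x, 0 ≤ x → f1 x ≤ 0 := by
    intro x0 hx0
    by_contra hcon
    push Not at hcon
    have hm : MonotoneOn (fun x => f x - f1 x0 * x) (Ici x0) := by
      apply monotoneOn_of_deriv_nonneg (convex_Ici x0) (by fun_prop)
        (fun x _ => ((hf x).sub ((hasDerivAt_id x).const_mul (f1 x0))).differentiableAt.differentiableWithinAt)
      intro x hx
      rw [interior_Ici] at hx
      have hx : x0 < x := hx
      have := ((hf x).sub ((hasDerivAt_id x).const_mul (f1 x0))).deriv
      have h2 := mono1 (show x0 ∈ Ici 0 from hx0) (show x ∈ Ici 0 from hx0.trans hx.le) hx.le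
      have e : deriv (fun x => f x - f1 x0 * x) x = f1 x - f1 x0 * 1 := this
      rw [this]; linarith
    have h3 := hM (x0 + (M + 1 ) / f1 x0) ?_
    · have hMp : 0 ≤ M := (hpos 0 le_rfl).le.trans (hM 0 le_rfl)
      have h4 := hm (show x0 ∈ Ici x0 from self_mem_Ici)
        (show x0 + (M+1) / f1 x0 ∈ Ici x0 from by simp; positivity) (by simp; positivity)
      simp only at h4
      have : f1 x0 * (x0 + (M + 1) / f1 x0) = f1 x0 * x0 + (M+1) := by field_simp
      rw [this] at h4
      have := hpos x0 hx0
      linarith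
    · have hMp : 0 ≤ M := (hpos 0 le_rfl).le.trans (hM 0 le_rfl)
      positivity
  have hsum : ∀ x, 1 ≤ x → f1 x + f x ≤ 0 := by
    intro x0 hx0
    by_contra hcon
    push Not at hcon
    have hder : ∀ x, HasDerivAt (fun x => (f1 x + f x) * Real.exp (-x)) ((x - 1) * f x * Real.exp (-x)) x := by
      intro x
      have := ((hf1 x).add (hf x)).mul (hasDerivAt_neg x).exp
      convert! this using 1
      simp; ring
    have hm : MonotoneOn (fun x => (f1 x + f x) * Real.exp (-x)) (Ici 1) := by
      apply monotoneOn_of_deriv_nonneg (convex_Ici 1) (by fun_prop)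
        (fun x _ => (hder x).differentiableAt.differentiableWithinAt)
      intro x hx
      rw [interior_Ici] at hx
      have hx : 1 < x := hx
      rw [(hder x).deriv]
      have := hpos x (by linarith)
      have : 0 ≤ x - 1 := by linarith
      positivity
    obtain ⟨x, hx, hx2⟩ := exp_unbdd ((f1 x0 + f x0) * Real.exp (-x0)) M
      (mul_pos hcon (Real.exp_pos _)) x0
    have h4 := hm (show x0 ∈ Ici 1 from hx0) (show x ∈ Ici 1 from hx0.trans hx) hx
    simp only at h4
    have h5 : (f1 x0 + f x0) * Real.exp (-x0) * Real.exp x ≤ f1 x + f x := by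
      calc _ ≤ (f1 x + f x) * Real.exp (-x) * Real.exp x := by gcongr
        _ = _ := by rw [mul_assoc, ← Real.exp_add]; simp
    have := hM x (by linarith)
    have := neg1 x (by linarith)
    linarith
  refine ⟨fun x hx => neg1 x (by linarith), ?_, ?_⟩
  · have hder : ∀ x, HasDerivAt (fun x => f x * Real.exp x) ((f1 x + f x) * Real.exp x) x := by
      intro x
      have := (hf x).mul (Real.hasDerivAt_exp x)
      convert! this using 1
      ring
    have hm : AntitoneOn (fun x => f x * Real.exp x) (Ici 1) := by
      apply antitoneOn_of_deriv_nonpos (convex_Ici 1) (by fun_prop)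
        (fun x _ => (hder x).differentiableAt.differentiableWithinAt)
      intro x hx
      rw [interior_Ici] at hx
      have hx : 1 < x := hx
      rw [(hder x).deriv]
      exact mul_nonpos_of_nonpos_of_nonneg (hsum x hx.le) (Real.exp_nonneg _)
    intro x hx
    have h4 := hm (show (1:ℝ) ∈ Ici 1 from self_mem_Ici) (show x ∈ Ici 1 from hx) hx
    simp only at h4
    calc f x = f x * Real.exp x * Real.exp (-x) := by rw [mul_assoc, ← Real.exp_add]; simp
      _ ≤ _ := by gcongr
  · intro x0 hx0
    by_contra hcon
    push Not at hcon
    have hder : ∀ x, HasDerivAt (fun x => (f1 x + (x+2) * f x) * Real.exp (-(x^2/2+2*x)))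
        ((x + 1 - (x+2)^2) * f x * Real.exp (-(x^2/2+2*x))) x := by
      intro x
      have hp : HasDerivAt (fun x : ℝ => -(x^2/2+2*x)) (-(x + 2)) x := by
        have := ((((hasDerivAt_id x).pow 2).div_const 2).add ((hasDerivAt_id x).const_mul 2)).neg
        convert! this using 1
        simp
      have := ((hf1 x).add ((((hasDerivAt_id x).add_const 2)).mul (hf x))).mul hp.exp
      convert! this using 1
      simp; ring
    have hm : AntitoneOn (fun x => (f1 x + (x+2) * f x) * Real.exp (-(x^2/2+2*x))) (Ici 1) := by
      apply antitoneOn_of_deriv_nonpos (convex_Ici 1) (by fun_prop)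
        (fun x _ => (hder x).differentiableAt.differentiableWithinAt)
      intro x hx
      rw [interior_Ici] at hx
      have hx : 1 < x := hx
      rw [(hder x).deriv]
      have := hpos x (by linarith)
      have : x + 1 - (x+2)^2 ≤ 0 := by nlinarith
      apply mul_nonpos_of_nonpos_of_nonneg _ (Real.exp_nonneg _)
      apply mul_nonpos_of_nonpos_of_nonneg this (by linarith)
    have hc : 0 < -((f1 x0 + (x0+2) * f x0) * Real.exp (-(x0^2/2+2*x0))) := by
      have := Real.exp_pos (-(x0^2/2+2*x0))
      nlinarith
    obtain ⟨x, hx, hx2⟩ := exp_unbdd _ (- f1 0) hc x0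
    have h4 := hm (show x0 ∈ Ici 1 from hx0) (show x ∈ Ici 1 from hx0.trans hx) hx
    simp only at h4
    have hx0' : 0 < x := by linarith
    have h6 := mono1 (show (0:ℝ) ∈ Ici 0 from self_mem_Ici) (show x ∈ Ici 0 from hx0'.le) hx0'.le
    have h7 := hpos x hx0'.le
    have h5 : -((f1 x0 + (x0+2) * f x0) * Real.exp (-(x0^2/2+2*x0))) * Real.exp x ≤ -(f1 x + (x+2) * f x) := by
      calc _ ≤ -((f1 x0 + (x0+2) * f x0) * Real.exp (-(x0^2/2+2*x0))) * Real.exp (x^2/2+2*x) := by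
            gcongr; nlinarith
        _ ≤ -((f1 x + (x+2) * f x) * Real.exp (-(x^2/2+2*x))) * Real.exp (x^2/2+2*x) := by gcongr
        _ = _ := by rw [← neg_mul, mul_assoc, ← Real.exp_add]; simp
    nlinarith

lemma airy_facts (α : ℝ) (hα : 0 < α) (hl : ∀ x : ℝ, -α < x → Ai x ≠ 0) :
    ∃ C : ℝ, 0 < C ∧ (∀ x, 1 ≤ x → |Ai x| ≤ C * Real.exp (-x)) ∧
    (∀ x, 1 ≤ x → |Ai1 x| ≤ (x + 2) * |Ai x|) ∧
    (∀ x y, 1 ≤ x → x ≤ y → |Ai y| ≤ |Ai x|) := by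
  -- generic positive version
  have gen : ∀ f f1 : ℝ → ℝ, (∀ x, HasDerivAt f (f1 x) x) → (∀ x, HasDerivAt f1 (x * f x) x) →
      (∀ x, 0 ≤ x → 0 < f x) → (∃ M, ∀ x, 0 ≤ x → f x ≤ M) →
      ∃ C : ℝ, 0 < C ∧ (∀ x, 1 ≤ x → |f x| ≤ C * Real.exp (-x)) ∧
      (∀ x, 1 ≤ x → |f1 x| ≤ (x + 2) * |f x|) ∧
      (∀ x y, 1 ≤ x → x ≤ y → |f y| ≤ |f x|) := by
    intro f f1 hf hf1 hpos ⟨M, hM⟩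
    obtain ⟨h1, h2, h3⟩ := airy_pos_facts f f1 hf hf1 hpos M hM
    have cf : Continuous f := continuous_iff_continuousAt.2 fun x => (hf x).continuousAt
    have ab : ∀ x, 1 ≤ x → |f x| = f x := fun x hx => abs_of_pos (hpos x (by linarith))
    refine ⟨f 1 * Real.exp 1, mul_pos (hpos 1 (by norm_num)) (Real.exp_pos _), ?_, ?_, ?_⟩
    · intro x hx; rw [ab x hx]; exact h2 x hx
    · intro x hx; rw [ab x hx, abs_of_nonpos (h1 x hx)]; exact h3 x hx
    · intro x y hx hxy
      rw [ab x hx, ab y (hx.trans hxy)]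
      have hm : AntitoneOn f (Ici 1) := by
        apply antitoneOn_of_deriv_nonpos (convex_Ici 1) (by fun_prop)
          (fun x _ => (hf x).differentiableAt.differentiableWithinAt)
        intro x hx
        rw [interior_Ici] at hx
        have hx : 1 < x := hx
        rw [(hf x).deriv]
        exact h1 x hx.le
      exact hm hx (hx.trans hxy) hxy
  obtain ⟨M, hM⟩ := Ai_bdd
  have cA : Continuous Ai := continuous_iff_continuousAt.2 fun x => (hasDerivAt_Ai x).continuousAt
  have nz : ∀ x ∈ Ici (0:ℝ), Ai x ≠ 0 := fun x hx => hl x (by have : (0:ℝ) ≤ x := hx; linarith)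
  rcases lt_or_gt_of_ne (nz 0 self_mem_Ici) with h0 | h0
  · have hneg : ∀ x, 0 ≤ x → Ai x < 0 := by
      intro x hx
      by_contra hcon
      push Not at hcon
      obtain ⟨z, hz, hz0⟩ := intermediate_value_Icc hx cA.continuousOn (show (0:ℝ) ∈ Icc (Ai 0) (Ai x) from ⟨h0.le, hcon⟩)
      exact nz z hz.1 hz0
    have := gen (fun x => - Ai x) (fun x => - Ai1 x) (fun x => (hasDerivAt_Ai x).neg)
      (fun x => by have := (hasDerivAt_Ai1 x).neg; convert! this using 1; ring)
      (fun x hx => by have := hneg x hx; linarith) ⟨M, fun x hx => (neg_le_abs _).trans (hM x hx)⟩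
    simpa using this
  · have hp : ∀ x, 0 ≤ x → 0 < Ai x := by
      intro x hx
      by_contra hcon
      push Not at hcon
      obtain ⟨z, hz, hz0⟩ := intermediate_value_Icc' hx cA.continuousOn (show (0:ℝ) ∈ Icc (Ai x) (Ai 0) from ⟨hcon, h0.le⟩)
      exact nz z hz.1 hz0
    exact gen Ai Ai1 hasDerivAt_Ai hasDerivAt_Ai1 hp ⟨M, fun x hx => (le_abs_self _).trans (hM x hx)⟩

structure AiryData (f f1 : ℝ → ℝ) (α M γ : ℝ) : Prop where
  hα : 0 < α
  Mpos : 0 < M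
  γpos : 0 < γ
  d0 : ∀ x, HasDerivAt f (f1 x) x
  d1 : ∀ x, HasDerivAt f1 ((x - α) * f x) x
  z : f 0 = 0
  nz : ∀ x, 0 < x → f x ≠ 0
  nz1 : f1 0 ≠ 0
  b0 : ∀ x, 0 ≤ x → |f x| ≤ M * Real.exp (-(x/2))
  b1 : ∀ x, 0 ≤ x → |f1 x| ≤ M * Real.exp (-(x/2))
  gap : ∀ x, 0 < x → γ * f x ^ 2 ≤ 2 * f1 x ^ 2 - (x - α) * f x ^ 2
  lin : ∀ x, 1 + α ≤ x → |f1 x| ≤ (x + 2) * |f x|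
  anti : ∀ x y, 1 + α ≤ x → x ≤ y → |f y| ≤ |f x|
  nrm : ∫ x in Ioi (0:ℝ), f x ^ 2 = f1 0 ^ 2
  int : IntegrableOn (fun x => f x ^ 2) (Ioi 0)

lemma tendsto_mul_exp_neg_half : Tendsto (fun x : ℝ => x * Real.exp (-(x/2))) atTop (𝓝 0) := by
  have := Real.tendsto_pow_mul_exp_neg_atTop_nhds_zero 1
  have h2 := (this.comp (tendsto_id.atTop_div_const (show (0:ℝ) < 2 by norm_num))).const_mul 2
  simp only [mul_zero] at h2
  refine h2.congr ?_
  intro x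
  simp
  ring

lemma airyData (α : ℝ) (hα : 0 < α) (hz : Ai (-α) = 0) (hl : ∀ x : ℝ, -α < x → Ai x ≠ 0) :
    ∃ M γ, AiryData (fun x => Ai (x - α)) (fun x => Ai1 (x - α)) α M γ := by
  obtain ⟨C, hC, hd, hlin, hanti⟩ := airy_facts α hα hl
  have cA : Continuous Ai := continuous_iff_continuousAt.2 fun x => (hasDerivAt_Ai x).continuousAt
  have cA1 : Continuous Ai1 := continuous_iff_continuousAt.2 fun x => (hasDerivAt_Ai1 x).continuousAt
  have d0 : ∀ x, HasDerivAt (fun x => Ai (x - α)) (Ai1 (x - α)) x := fun x =>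
    (hasDerivAt_Ai (x - α)).comp_sub_const x α
  have d1 : ∀ x, HasDerivAt (fun x => Ai1 (x - α)) ((x - α) * Ai (x - α)) x := fun x =>
    (hasDerivAt_Ai1 (x - α)).comp_sub_const x α
  -- exponential bounds
  have hd1 : ∀ x, 1 ≤ x → |Ai1 x| ≤ 2 * C * Real.exp (-(x/2)) := by
    intro x hx
    refine (hlin x hx).trans ?_
    have h1 := hd x hx
    have h2 := Real.add_one_le_exp (x/2)
    have e : Real.exp (-x) = Real.exp (-(x/2)) * Real.exp (-(x/2)) := by
      rw [← Real.exp_add]; congr 1; ring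
    have e2 : Real.exp (x/2) * Real.exp (-(x/2)) = 1 := by rw [← Real.exp_add]; simp
    calc (x+2) * |Ai x| ≤ (2 * Real.exp (x/2)) * (C * Real.exp (-x)) := by
          gcongr; linarith
      _ = 2 * C * (Real.exp (x/2) * Real.exp (-(x/2))) * Real.exp (-(x/2)) := by rw [e]; ring
      _ = _ := by rw [e2]; ring
  obtain ⟨B0, hB0⟩ := (isCompact_Icc (a := -α) (b := 1)).exists_bound_of_continuousOn cA.continuousOn
  obtain ⟨B1, hB1⟩ := (isCompact_Icc (a := -α) (b := 1)).exists_bound_of_continuousOn cA1.continuousOn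
  have hB0p : 0 ≤ B0 := (norm_nonneg _).trans (hB0 1 ⟨by linarith, le_rfl⟩)
  have hB1p : 0 ≤ B1 := (norm_nonneg _).trans (hB1 1 ⟨by linarith, le_rfl⟩)
  set M : ℝ := (2 * C + B0 + B1) * Real.exp ((1+α)/2) with hMdef
  have hMp : 0 < M := by positivity
  have bb : ∀ g : ℝ → ℝ, (∀ x, 1 ≤ x → |g x| ≤ 2 * C * Real.exp (-(x/2))) →
      (∀ x ∈ Icc (-α) 1, |g x| ≤ B0 + B1) → ∀ x, 0 ≤ x → |g (x - α)| ≤ M * Real.exp (-(x/2)) := by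
    intro g h1 h2 x hx
    rw [hMdef, mul_assoc, ← Real.exp_add]
    rcases le_total 1 (x - α) with h | h
    · refine (h1 _ h).trans ?_
      gcongr
      · linarith
      · linarith
    · refine (h2 _ ⟨by linarith, h⟩).trans ?_
      have : (1:ℝ) ≤ Real.exp ((1 + α)/2 + -(x/2)) := by
        rw [Real.one_le_exp_iff]; linarith
      nlinarith
  have b0 := bb Ai (fun x hx => (hd x hx).trans (by
      gcongr
      · linarith
      · linarith)) (fun x hx => (hB0 x hx).trans (by linarith))
  have b1 := bb Ai1 hd1 (fun x hx => (hB1 x hx).trans (by linarith))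
  -- the function h
  set h : ℝ → ℝ := fun x => Ai1 (x - α) ^ 2 - (x - α) * Ai (x - α) ^ 2 with hh
  have dh : ∀ x, HasDerivAt h (-(Ai (x - α)) ^ 2) x := by
    intro x
    have := ((d1 x).pow 2).sub ((((hasDerivAt_id x).sub_const α)).mul ((d0 x).pow 2))
    convert! this using 1
    simp; ring
  have ch : Continuous h := continuous_iff_continuousAt.2 fun x => (dh x).continuousAt
  have hanti' : AntitoneOn h univ := by
    apply antitoneOn_of_deriv_nonpos convex_univ ch.continuousOn
      (fun x _ => (dh x).differentiableAt.differentiableWithinAt)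
    intro x _
    rw [(dh x).deriv]
    have := sq_nonneg (Ai (x - α))
    linarith
  have hstrict : StrictAntiOn h (Ici 0) := by
    apply strictAntiOn_of_deriv_neg (convex_Ici 0) ch.continuousOn
    intro x hx
    rw [interior_Ici] at hx
    have hx : 0 < x := hx
    rw [(dh x).deriv]
    have := hl (x - α) (by linarith)
    have : 0 < (Ai (x - α)) ^ 2 := by positivity
    linarith
  have hlim : Tendsto h atTop (𝓝 0) := by
    have hx1 : Tendsto (fun x : ℝ => M * Real.exp (-(x/2))) atTop (𝓝 0) := by
      have : Tendsto (fun x : ℝ => Real.exp (-(x/2))) atTop (𝓝 0) :=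
        Real.tendsto_exp_neg_atTop_nhds_zero.comp (tendsto_id.atTop_div_const (by norm_num))
      simpa using this.const_mul M
    have t0 : Tendsto (fun x => Ai (x - α)) atTop (𝓝 0) := by
      apply squeeze_zero_norm' _ hx1
      filter_upwards [eventually_ge_atTop 0] with x hx using b0 x hx
    have t1 : Tendsto (fun x => Ai1 (x - α)) atTop (𝓝 0) := by
      apply squeeze_zero_norm' _ hx1
      filter_upwards [eventually_ge_atTop 0] with x hx using b1 x hx
    have t2 : Tendsto (fun x => x * Ai (x - α)) atTop (𝓝 0) := by
      have := tendsto_mul_exp_neg_half.const_mul M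
      rw [mul_zero] at this
      apply squeeze_zero_norm' _ this
      filter_upwards [eventually_ge_atTop 0] with x hx
      rw [norm_mul, Real.norm_of_nonneg hx]
      have := b0 x hx
      calc x * ‖Ai (x - α)‖ ≤ x * (M * Real.exp (-(x/2))) := by gcongr; exact this
        _ = _ := by ring
    have := ((t1.mul t1).sub (t2.mul t0)).add ((t0.mul t0).const_mul α)
    simp only [mul_zero, sub_zero, add_zero] at this
    refine this.congr ?_
    intro x
    simp only [hh]; ring
  have hnn : ∀ x, 0 ≤ h x := by
    intro x
    refine le_of_tendsto hlim ?_
    filter_upwards [eventually_ge_atTop x] with y hy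
    exact hanti' (mem_univ _) (mem_univ _) hy
  have hpos : ∀ x, 0 ≤ x → 0 < h x := by
    intro x hx
    have := hstrict (show x ∈ Ici 0 from hx) (show x + 1 ∈ Ici 0 from by
      have : 0 ≤ x + 1 := by linarith
      exact this) (by linarith)
    exact (hnn _).trans_lt this
  have hint : IntegrableOn (fun x => Ai (x - α) ^ 2) (Ioi 0) := by
    have := integrableOn_Ioi_deriv_of_nonpos' (a := 0) (fun x _ => dh x)
      (fun x _ => by have := sq_nonneg (Ai (x - α)); linarith) hlim
    have := this.neg
    refine this.congr (Eventually.of_forall fun x => ?_)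
    simp
  have hnrm : ∫ x in Ioi (0:ℝ), Ai (x - α) ^ 2 = Ai1 (0 - α) ^ 2 := by
    have := integral_Ioi_of_hasDerivAt_of_nonpos' (a := 0) (fun x _ => dh x)
      (fun x _ => by have := sq_nonneg (Ai (x - α)); linarith) hlim
    rw [integral_neg] at this
    have e : h 0 = Ai1 (0 - α)^2 := by simp [hh, hz]
    rw [e] at this
    linarith
  refine ⟨M, min 1 (h (1 + α) / (M ^ 2)), hα, hMp, ?_, d0, d1, by simpa using hz,
    fun x hx => hl _ (by linarith), ?_, b0, b1, ?_, ?_, ?_, hnrm, hint⟩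
  · exact lt_min one_pos (div_pos (hpos _ (by linarith)) (by positivity))
  · intro h0
    have := hpos 0 le_rfl
    simp only [hh] at this
    rw [h0] at this
    simp [hz] at this
  · intro x hx
    have e : 2 * Ai1 (x - α) ^ 2 - (x - α) * Ai (x - α) ^ 2 = h x + Ai1 (x - α)^2 := by
      simp only [hh]; ring
    show _ ≤ 2 * Ai1 (x - α) ^ 2 - (x - α) * Ai (x - α) ^ 2
    rcases le_total (1 + α) x with hx1 | hx1
    · have h1 := hnn x
      have h2 : min 1 (h (1 + α) / (M ^ 2)) ≤ 1 := min_le_left _ _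
      have h3 : 1 * Ai (x - α)^2 ≤ (x - α) * Ai (x - α) ^ 2 := by
        gcongr; linarith
      have h4 : Ai1 (x - α) ^ 2 = h x + (x - α) * Ai (x - α) ^ 2 := by simp only [hh]; ring
      have h5 : min 1 (h (1 + α) / (M ^ 2)) * Ai (x - α)^2 ≤ 1 * Ai (x - α)^2 := by gcongr
      linarith
    · have h1 := hanti' (mem_univ x) (mem_univ (1 + α)) hx1
      have h2 : min 1 (h (1 + α) / (M ^ 2)) ≤ h (1 + α) / M ^2 := min_le_right _ _
      have h3 : Ai (x - α)^2 ≤ M ^ 2 := by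
        rw [← sq_abs]
        have : |Ai (x - α)| ≤ M := (b0 x hx.le).trans (by
          have : Real.exp (-(x/2)) ≤ 1 := by rw [Real.exp_le_one_iff]; linarith
          nlinarith)
        gcongr
      have h4 : 0 < h (1+α) := hpos _ (by linarith)
      have h5 : min 1 (h (1 + α) / (M ^ 2)) * Ai (x - α)^2 ≤ h (1 + α) / M ^2 * M^2 := by
        gcongr
      have h6 : h (1 + α) / M ^2 * M^2 = h (1 + α) := by field_simp
      have := sq_nonneg (Ai1 (x - α))
      linarith
  · intro x hx
    refine (hlin (x - α) (by linarith)).trans ?_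
    gcongr
    linarith
  · intro x y hx hxy
    exact hanti _ _ (by linarith) (by linarith)

lemma tendsto_lin_exp (δ : ℝ) (hδ : 0 < δ) :
    Tendsto (fun x : ℝ => (x + 1) * Real.exp (-δ * x)) atTop (𝓝 0) := by
  have h1 := (Real.tendsto_pow_mul_exp_neg_atTop_nhds_zero 1).comp
    (tendsto_id.const_mul_atTop hδ)
  have h0 := (Real.tendsto_exp_neg_atTop_nhds_zero).comp
    (tendsto_id.const_mul_atTop hδ)
  have h2 := (h1.const_mul δ⁻¹).add h0
  simp only [mul_zero, add_zero] at h2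
  refine h2.congr ?_
  intro x
  simp
  field_simp

lemma integrableOn_exp_neg (δ : ℝ) (hδ : 0 < δ) (a : ℝ) :
    IntegrableOn (fun x : ℝ => Real.exp (-δ * x)) (Ioi a) :=
  integrableOn_exp_mul_Ioi (by linarith) a

lemma gap_lemma (φ φ1 V u u1 u2 : ℝ → ℝ) (γ M C δ X : ℝ) (hγ : 0 < γ) (hM : 0 < M) (hC : 0 < C)
    (hδ : 0 < δ) (hX : 0 < X)
    (hφ : ∀ x, HasDerivAt φ (φ1 x) x) (hφ1 : ∀ x, HasDerivAt φ1 (V x * φ x) x)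
    (hz : φ 0 = 0) (hnz : ∀ x, 0 < x → φ x ≠ 0) (hnz1 : φ1 0 ≠ 0)
    (b0 : ∀ x, 0 ≤ x → |φ x| ≤ M) (b1 : ∀ x, 0 ≤ x → |φ1 x| ≤ M)
    (gap : ∀ x, 0 < x → γ * φ x ^ 2 ≤ 2 * φ1 x ^ 2 - V x * φ x ^ 2)
    (lin : ∀ x, X ≤ x → |φ1 x| ≤ M * (x + 1) * |φ x|)
    (anti : ∀ x y, X ≤ x → x ≤ y → |φ y| ≤ |φ x|)
    (hu : ∀ x, 0 < x → HasDerivAt u (u1 x) x) (hu1 : ∀ x, 0 < x → HasDerivAt u1 (u2 x) x)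
    (bu : ∀ x, 0 < x → |u x| ≤ C * Real.exp (-δ * x)) (bux : ∀ x, 0 < x → |u x| ≤ C * x)
    (bu1 : ∀ x, 0 < x → |u1 x| ≤ C)
    (orth : ∫ x in Ioi (0:ℝ), φ x * u x = 0)
    (hint : IntegrableOn (fun x => u x * (u2 x - V x * u x)) (Ioi 0)) :
    ∫ x in Ioi (0:ℝ), u x * (u2 x - V x * u x) ≤ - γ * ∫ x in Ioi (0:ℝ), u x ^ 2 := by
  have cφ : Continuous φ := continuous_iff_continuousAt.2 fun x => (hφ x).continuousAt
  have cu : ContinuousOn u (Ioi 0) := fun x hx => (hu x hx).continuousAt.continuousWithinAt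
  have iφu : IntegrableOn (fun x => φ x * u x) (Ioi 0) := by
    refine Integrable.mono' ((integrableOn_exp_neg δ hδ 0).const_mul (M * C)) ?_ ?_
    · exact (cφ.continuousOn.mul cu).aestronglyMeasurable measurableSet_Ioi
    · refine (ae_restrict_iff' measurableSet_Ioi).2 (Eventually.of_forall fun s hs => ?_)
      have hs : 0 < s := hs
      rw [norm_mul, mul_assoc]
      exact mul_le_mul (b0 s hs.le) (bu s hs) (norm_nonneg _) hM.le
  have iu2 : IntegrableOn (fun x => u x ^ 2) (Ioi 0) := by
    refine Integrable.mono' ((integrableOn_exp_neg δ hδ 0).const_mul (C * C)) ?_ ?_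
    · exact (cu.pow 2).aestronglyMeasurable measurableSet_Ioi
    · refine (ae_restrict_iff' measurableSet_Ioi).2 (Eventually.of_forall fun s hs => ?_)
      have hs : 0 < s := hs
      rw [norm_pow, sq, mul_assoc]
      have h1 : ‖u s‖ ≤ C := (bu s hs).trans (by
        have : Real.exp (-δ * s) ≤ 1 := by rw [Real.exp_le_one_iff]; nlinarith
        nlinarith)
      exact mul_le_mul h1 (bu s hs) (norm_nonneg _) hC.le
  set F : ℝ → ℝ := fun x => ∫ s in (0:ℝ)..x, φ s * u s with hF
  have ii : ∀ x, 0 < x → IntervalIntegrable (fun x => φ x * u x) volume 0 x := by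
    intro x hx
    rw [intervalIntegrable_iff_integrableOn_Ioc_of_le hx.le]
    exact iφu.mono_set Ioc_subset_Ioi_self
  have dF : ∀ x, 0 < x → HasDerivAt F (φ x * u x) x := by
    intro x hx
    refine intervalIntegral.integral_hasDerivAt_right (ii x hx) ?_
      (cφ.continuousAt.mul (hu x hx).continuousAt)
    exact ((cφ.continuousOn.mul cu).stronglyMeasurableAtFilter isOpen_Ioi) x hx
  set p : ℝ → ℝ := fun x => φ1 x / φ x with hp
  set G : ℝ → ℝ := fun x => F x / φ x with hG
  have dp : ∀ x, 0 < x → HasDerivAt p (V x - p x ^ 2) x := by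
    intro x hx
    have := (hφ1 x).div (hφ x) (hnz x hx)
    convert! this using 1
    have := hnz x hx
    simp only [hp]; field_simp
  have dG : ∀ x, 0 < x → HasDerivAt G (u x - p x * G x) x := by
    intro x hx
    have := (dF x hx).div (hφ x) (hnz x hx)
    convert! this using 1
    have := hnz x hx
    simp only [hp, hG]; field_simp
  set J : ℝ → ℝ := fun x => u x * u1 x - (p x * u x ^ 2 - 2 * γ * (u x * G x) + γ * (p x * G x ^ 2))
    with hJ
  have dJ : ∀ x, 0 < x → HasDerivAt J (u1 x ^ 2 + u x * u2 x - ((V x - p x^2) * u x ^ 2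
      + 2 * p x * u x * u1 x - 2 * γ * (u1 x * G x + u x * (u x - p x * G x))
      + γ * ((V x - p x ^2) * G x ^ 2 + 2 * p x * G x * (u x - p x * G x)))) x := by
    intro x hx
    have := ((hu x hx).mul (hu1 x hx)).sub ((((dp x hx).mul ((hu x hx).pow 2)).sub
      (((hu x hx).mul (dG x hx)).const_mul (2 * γ))).add
      (((dp x hx).mul ((dG x hx).pow 2)).const_mul γ))
    convert! this using 1
    simp; ring
  have key : ∀ x, 0 < x → u x * (u2 x - V x * u x) + γ * u x ^ 2 ≤ u1 x ^ 2 + u x * u2 x - ((V x - p x^2) * u x ^ 2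
      + 2 * p x * u x * u1 x - 2 * γ * (u1 x * G x + u x * (u x - p x * G x))
      + γ * ((V x - p x ^2) * G x ^ 2 + 2 * p x * G x * (u x - p x * G x))) := by
    intro x hx
    have h1 : 0 ≤ 2 * p x ^ 2 - V x - γ := by
      have h2 := gap x hx
      have h3 := hnz x hx
      have h4 : 0 < φ x ^ 2 := by positivity
      have e : (2 * p x ^ 2 - V x - γ) = (2 * φ1 x ^ 2 - V x * φ x ^ 2 - γ * φ x ^ 2) / φ x ^ 2 := by
        simp only [hp]; field_simp
      rw [e]
      apply div_nonneg _ h4.le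
      linarith
    have h2 : 0 ≤ γ * G x ^ 2 * (2 * p x ^ 2 - V x - γ) := by positivity
    have h3 := sq_nonneg (u1 x - p x * u x + γ * G x)
    have h4 : 0 ≤ γ * (u x - p x * G x) ^ 2 := by positivity
    nlinarith
  set f : ℝ → ℝ := fun x => u x * (u2 x - V x * u x) + γ * u x ^ 2 with hf
  have intf : IntegrableOn f (Ioi 0) := hint.add (iu2.const_mul γ)
  have step1 : ∀ a b, 0 < a → a ≤ b → (∫ x in a..b, f x) ≤ J b - J a := by
    intro a b ha hab
    refine intervalIntegral.integral_le_sub_of_hasDeriv_right_of_le hab ?_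
      (fun x hx => (dJ x (ha.trans hx.1)).hasDerivWithinAt) ?_ (fun x hx => key x (ha.trans hx.1))
    · intro x hx
      exact (dJ x (ha.trans_le hx.1)).continuousAt.continuousWithinAt
    · exact intf.mono_set (fun x hx => ha.trans_le hx.1)
  -- behaviour at zero
  have bφx : ∀ x, 0 < x → |φ x| ≤ M * x := by
    intro x hx
    have := (convex_Ici (0:ℝ)).norm_image_sub_le_of_norm_hasDerivWithin_le
      (fun y _ => (hφ y).hasDerivWithinAt) (fun y hy => b1 y hy) (self_mem_Ici)
      (show x ∈ Ici (0:ℝ) from hx.le)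
    rw [hz] at this
    simpa [abs_of_pos hx] using this
  obtain ⟨c, hc, hlow⟩ : ∃ c, 0 < c ∧ ∀ᶠ x in 𝓝[>] (0:ℝ), c * x ≤ |φ x| := by
    refine ⟨|φ1 0| / 2, by positivity, ?_⟩
    have h1 := ((hasDerivAt_iff_tendsto_slope.1 (hφ 0)).mono_left
      (nhdsWithin_mono 0 (fun x (hx : 0 < x) => hx.ne'))).abs
    have h2 := h1.eventually (lt_mem_nhds (show |φ1 0| / 2 < |φ1 0| by
      have : 0 < |φ1 0| := by positivity
      linarith))
    filter_upwards [h2, self_mem_nhdsWithin] with x hx hx0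
    have hx0 : 0 < x := hx0
    rw [slope_def_field, hz, sub_zero, sub_zero, abs_div, abs_of_pos hx0, lt_div_iff₀ hx0] at hx
    exact hx.le
  have bF : ∀ x, 0 < x → |F x| ≤ M * C * x ^ 3 := by
    intro x hx
    have := intervalIntegral.norm_integral_le_of_norm_le_const (a := 0) (b := x)
      (f := fun s => φ s * u s) (C := M * C * x ^ 2) (by
        intro s hs
        rw [uIoc_of_le hx.le] at hs
        rw [norm_mul]
        have h1 := bφx s hs.1
        have h2 := bux s hs.1
        calc ‖φ s‖ * ‖u s‖ ≤ (M * s) * (C * s) := mul_le_mul h1 h2 (norm_nonneg _) (by have := hs.1; positivity)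
          _ = M * C * s ^ 2 := by ring
          _ ≤ _ := by have := hs.1; have := hs.2; gcongr)
    rw [sub_zero, abs_of_pos hx] at this
    refine this.trans (le_of_eq (by ring))
  have J0 : Tendsto J (𝓝[>] 0) (𝓝 0) := by
    have hpoly : Tendsto (fun x : ℝ => C * x * C + (M / c * C ^ 2 * x + 2 * γ * (C * x * (M * C / c * x^2))
        + γ * (M / c * (M * C / c) ^ 2 * x ^ 3))) (𝓝[>] 0) (𝓝 0) := by
      refine Tendsto.mono_left ?_ nhdsWithin_le_nhds
      have : Continuous (fun x : ℝ => C * x * C + (M / c * C ^ 2 * x + 2 * γ * (C * x * (M * C / c * x^2))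
        + γ * (M / c * (M * C / c) ^ 2 * x ^ 3))) := by fun_prop
      have := this.tendsto 0
      simpa using this
    refine squeeze_zero_norm' ?_ hpoly
    filter_upwards [hlow, self_mem_nhdsWithin] with x hx hx0
    have hx0 : 0 < x := hx0
    have hpx : |p x| ≤ M / c * x⁻¹ := by
      simp only [hp]
      rw [abs_div]
      calc |φ1 x| / |φ x| ≤ M / (c * x) := by gcongr; exact b1 x hx0.le
        _ = _ := by field_simp
    have hGx : |G x| ≤ M * C / c * x ^ 2 := by
      simp only [hG]
      rw [abs_div]
      calc |F x| / |φ x| ≤ M * C * x ^ 3 / (c * x) := by gcongr; exact bF x hx0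
        _ = _ := by field_simp
    have e1 : |u x * u1 x| ≤ C * x * C := by
      rw [abs_mul]; gcongr
      · exact bux x hx0
      · exact bu1 x hx0
    have e2 : |p x * u x ^ 2| ≤ M / c * C ^ 2 * x := by
      rw [abs_mul, abs_pow]
      calc |p x| * |u x| ^ 2 ≤ (M / c * x⁻¹) * (C * x) ^ 2 := by gcongr; exact bux x hx0
        _ = _ := by field_simp
    have e3 : |2 * γ * (u x * G x)| ≤ 2 * γ * (C * x * (M * C / c * x^2)) := by
      rw [abs_mul, abs_of_pos (show 0 < 2 * γ by positivity), abs_mul]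
      gcongr; exact bux x hx0
    have e4 : |γ * (p x * G x ^ 2)| ≤ γ * (M / c * (M * C / c) ^ 2 * x ^ 3) := by
      rw [abs_mul, abs_mul, abs_pow, abs_of_pos hγ]
      refine mul_le_mul_of_nonneg_left ?_ hγ.le
      calc |p x| * |G x| ^ 2 ≤ (M / c * x⁻¹) * (M * C / c * x ^ 2) ^ 2 := by gcongr
        _ = _ := by field_simp
    simp only [hJ, Real.norm_eq_abs]
    refine (abs_sub _ _).trans ?_
    refine add_le_add e1 ?_
    refine (abs_add_le _ _).trans ?_
    refine add_le_add ?_ e4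
    exact (abs_sub _ _).trans (add_le_add e2 e3)
  have Jinf : Tendsto J atTop (𝓝 0) := by
    have hl := (tendsto_lin_exp δ hδ).const_mul (C * C + (M * C ^ 2 + 2 * γ * (C * (C / δ)) + γ * (M * (C/δ)^2)))
    rw [mul_zero] at hl
    refine squeeze_zero_norm' ?_ hl
    filter_upwards [eventually_ge_atTop X] with x hx
    have hx0 : 0 < x := hX.trans_le hx
    have hφ0 : 0 < |φ x| := abs_pos.2 (hnz x hx0)
    have hFx : |F x| ≤ |φ x| * (C / δ * Real.exp (-δ * x)) := by
      have h1 : F x = - ∫ s in Ioi x, φ s * u s := by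
        have := intervalIntegral.integral_interval_add_Ioi (a := 0) (b := x) (f := fun s => φ s * u s) (μ := volume)
          iφu (iφu.mono_set (Ioi_subset_Ioi hx0.le))
        rw [orth] at this
        simp only [hF]; linarith
      rw [h1, abs_neg]
      have h2 := norm_integral_le_of_norm_le (μ := volume.restrict (Ioi x)) (f := fun s => φ s * u s)
        ((integrableOn_exp_neg δ hδ x).const_mul (|φ x| * C)) (by
          refine (ae_restrict_iff' measurableSet_Ioi).2 (Eventually.of_forall fun s hs => ?_)
          have hs : x < s := hs
          rw [norm_mul, mul_assoc]
          exact mul_le_mul (anti x s hx hs.le) (bu s (hx0.trans hs)) (norm_nonneg _) hφ0.le)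
      rw [integral_const_mul, integral_exp_mul_Ioi (by linarith)] at h2
      refine h2.trans (le_of_eq ?_)
      field_simp
    have hE := Real.exp_pos (-δ * x)
    have hE1 : Real.exp (-δ * x) ≤ 1 := by rw [Real.exp_le_one_iff]; nlinarith
    set E := Real.exp (-δ * x) with hEdef
    have hEsq : E ^ 2 ≤ E := by nlinarith
    have hGx : |G x| ≤ C / δ * E := by
      simp only [hG]
      rw [abs_div, div_le_iff₀ hφ0]
      linarith
    have hpx : |p x| ≤ M * (x + 1) := by
      simp only [hp]
      rw [abs_div, div_le_iff₀ hφ0]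
      exact lin x hx
    have hux := bu x hx0
    have hx1 : E ≤ (x + 1) * E := by nlinarith
    have e1 : |u x * u1 x| ≤ C * C * ((x + 1) * E) := by
      rw [abs_mul]
      calc |u x| * |u1 x| ≤ (C * E) * C := by gcongr; exact bu1 x hx0
        _ = C * C * E := by ring
        _ ≤ _ := by gcongr
    have e2 : |p x * u x ^ 2| ≤ M * C ^ 2 * ((x+1) * E) := by
      rw [abs_mul, abs_pow]
      calc |p x| * |u x| ^ 2 ≤ (M * (x+1)) * (C * E) ^ 2 := by gcongr
        _ = M * C ^ 2 * ((x+1) * E^2) := by ring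
        _ ≤ _ := by gcongr
    have e3 : |2 * γ * (u x * G x)| ≤ 2 * γ * (C * (C / δ)) * ((x+1) * E) := by
      rw [abs_mul, abs_of_pos (show 0 < 2 * γ by positivity), abs_mul]
      calc 2 * γ * (|u x| * |G x|) ≤ 2 * γ * ((C * E) * (C / δ * E)) := by gcongr
        _ = 2 * γ * (C * (C / δ)) * E ^ 2 := by ring
        _ ≤ 2 * γ * (C * (C / δ)) * ((x+1) * E) := by gcongr; linarith
    have e4 : |γ * (p x * G x ^ 2)| ≤ γ * (M * (C/δ)^2) * ((x+1) * E) := by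
      rw [abs_mul, abs_mul, abs_pow, abs_of_pos hγ]
      calc γ * (|p x| * |G x| ^ 2) ≤ γ * ((M * (x+1)) * (C / δ * E) ^ 2) := by gcongr
        _ = γ * (M * (C/δ)^2) * ((x+1) * E^2) := by ring
        _ ≤ _ := by gcongr
    simp only [hJ, Real.norm_eq_abs]
    have t1 := abs_sub (u x * u1 x) (p x * u x ^ 2 - 2 * γ * (u x * G x) + γ * (p x * G x ^ 2))
    have t2 := abs_add_le (p x * u x ^ 2 - 2 * γ * (u x * G x)) (γ * (p x * G x ^ 2))
    have t3 := abs_sub (p x * u x ^ 2) (2 * γ * (u x * G x))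
    linarith
  -- conclusion
  have iif : ∀ a, 0 < a → IntervalIntegrable f volume 0 a := fun a ha => by
    rw [intervalIntegrable_iff_integrableOn_Ioc_of_le ha.le]
    exact intf.mono_set Ioc_subset_Ioi_self
  have I0 : Tendsto (fun a => ∫ x in (0:ℝ)..a, f x) (𝓝[>] 0) (𝓝 0) := by
    have h1 : IntegrableOn f (uIcc 0 1) := by
      rw [uIcc_of_le zero_le_one, integrableOn_Icc_iff_integrableOn_Ioc]
      exact intf.mono_set Ioc_subset_Ioi_self
    have h2 := intervalIntegral.continuousOn_primitive_interval h1
    have h3 := (h2 0 (by simp)).tendsto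
    simp only [intervalIntegral.integral_same] at h3
    refine h3.mono_left ?_
    rw [uIcc_of_le zero_le_one, ← nhdsWithin_Ioc_eq_nhdsGT zero_lt_one]
    exact nhdsWithin_mono _ Ioc_subset_Icc_self
  have step2 : ∀ b, 0 < b → (∫ x in (0:ℝ)..b, f x) ≤ J b := by
    intro b hb
    have h1 : Tendsto (fun a => J b - J a + ∫ x in (0:ℝ)..a, f x) (𝓝[>] 0) (𝓝 (J b - 0 + 0)) :=
      (tendsto_const_nhds.sub J0).add I0
    rw [sub_zero, add_zero] at h1
    refine ge_of_tendsto h1 ?_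
    filter_upwards [Ioo_mem_nhdsGT hb] with a ha
    have h2 := step1 a b ha.1 ha.2.le
    have h3 := intervalIntegral.integral_interval_sub_left (iif b hb) (iif a ha.1)
    linarith
  have step3 : ∫ x in Ioi (0:ℝ), f x ≤ 0 := by
    have h1 := intervalIntegral_tendsto_integral_Ioi (0:ℝ) intf tendsto_id
    refine le_of_tendsto_of_tendsto h1 Jinf ?_
    filter_upwards [eventually_gt_atTop 0] with b hb using step2 b hb
  simp only [hf] at step3
  rw [integral_add hint (iu2.const_mul γ), integral_const_mul] at step3
  linarith

lemma ode_stepA (a a' N N' : ℝ → ℝ) (κ ρ T A : ℝ) (hκ : 0 < κ) (hρ : 0 < ρ) (hT1 : T ≤ 1)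
    (hA : 0 ≤ A)
    (ca : ContinuousOn a (Icc 0 1)) (cN : ContinuousOn N (Icc 0 1))
    (da : ∀ t ∈ Ioo (0:ℝ) 1, HasDerivAt a (a' t) t) (dN : ∀ t ∈ Ioo (0:ℝ) 1, HasDerivAt N (N' t) t)
    (hS : ∀ t ∈ Icc (0:ℝ) 1, 0 ≤ N t - a t ^ 2)
    (ba : ∀ t ∈ Ioo (0:ℝ) 1, |a' t| ≤ κ * √(N t - a t ^ 2))
    (bN : ∀ t ∈ Ioo (0:ℝ) 1, N' t ≤ -2 * ρ * (N t - a t ^ 2))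
    (hN0 : N 0 ≤ 1) (haA : ∀ t ∈ Icc 0 T, |a t| ≤ A) :
    ∀ t ∈ Icc 0 T, √(N t - a t ^ 2) ≤ Real.exp (-ρ * t) + κ / ρ * A := by
  intro t ht
  have hT : 0 ≤ T := ht.1.trans ht.2
  have h01 : (0:ℝ) ∈ Icc (0:ℝ) 1 := ⟨le_rfl, zero_le_one⟩
  have ht1 : t ∈ Icc (0:ℝ) 1 := ⟨ht.1, ht.2.trans hT1⟩
  have main : Real.exp (ρ * t) * √(N t - a t ^ 2) ≤ 1 + κ / ρ * A * Real.exp (ρ * t) := by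
    refine le_of_forall_pos_le_add fun e he => ?_
    set Y : ℝ → ℝ := fun s => Real.exp (2 * ρ * s) * (N s - a s ^ 2) + e ^ 2 with hY
    have hYpos : ∀ s ∈ Icc (0:ℝ) 1, 0 < Y s := fun s hs => by
      have := hS s hs
      simp only [hY]; positivity
    have dY : ∀ s ∈ Ioo (0:ℝ) 1, HasDerivAt Y (Real.exp (2 * ρ * s) * (2 * ρ * (N s - a s ^2) + (N' s - 2 * a s * a' s))) s := by
      intro s hs
      have h1 : HasDerivAt (fun s : ℝ => Real.exp (2 * ρ * s)) (Real.exp (2 * ρ * s) * (2 * ρ * 1)) s :=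
        ((hasDerivAt_id s).const_mul (2 * ρ)).exp
      have := (h1.mul ((dN s hs).sub ((da s hs).pow 2))).add_const (e^2)
      convert! this using 1
      simp; ring
    have cZ : ContinuousOn (fun s => √(Y s) - κ / ρ * A * Real.exp (ρ * s)) (Icc 0 T) := by
      have : ContinuousOn Y (Icc 0 1) := by
        simp only [hY]; fun_prop
      have := this.mono (Icc_subset_Icc_right hT1)
      fun_prop
    have dZ : ∀ s ∈ Ioo (0:ℝ) T, HasDerivAt (fun s => √(Y s) - κ / ρ * A * Real.exp (ρ * s))
        (Real.exp (2 * ρ * s) * (2 * ρ * (N s - a s ^2) + (N' s - 2 * a s * a' s)) / (2 * √(Y s))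
          - κ / ρ * A * (Real.exp (ρ * s) * (ρ * 1))) s := by
      intro s hs
      have hs1 : s ∈ Ioo (0:ℝ) 1 := ⟨hs.1, hs.2.trans_le hT1⟩
      have h1 : HasDerivAt (fun s : ℝ => Real.exp (ρ * s)) (Real.exp (ρ * s) * (ρ * 1)) s :=
        ((hasDerivAt_id s).const_mul (ρ)).exp
      exact ((dY s hs1).sqrt (hYpos s ⟨hs1.1.le, hs1.2.le⟩).ne').sub (h1.const_mul _)
    have anti : AntitoneOn (fun s => √(Y s) - κ / ρ * A * Real.exp (ρ * s)) (Icc 0 T) := by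
      apply antitoneOn_of_deriv_nonpos (convex_Icc 0 T) cZ
      · rw [interior_Icc]
        exact fun s hs => (dZ s hs).differentiableAt.differentiableWithinAt
      · rw [interior_Icc]
        intro s hs
        rw [(dZ s hs).deriv]
        have hs1 : s ∈ Ioo (0:ℝ) 1 := ⟨hs.1, hs.2.trans_le hT1⟩
        have hs2 : s ∈ Icc (0:ℝ) 1 := ⟨hs1.1.le, hs1.2.le⟩
        have hYs := Real.sqrt_pos.2 (hYpos s hs2)
        rw [sub_nonpos, div_le_iff₀ (by positivity)]
        have e1 : 2 * ρ * (N s - a s ^2) + (N' s - 2 * a s * a' s) ≤ 2 * A * (κ * √(N s - a s ^ 2)) := by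
          have h1 := bN s hs1
          have h2 := ba s hs1
          have h3 := haA s ⟨hs.1.le, hs.2.le⟩
          have h4 : -(a s * a' s) ≤ A * (κ * √(N s - a s ^ 2)) := by
            calc -(a s * a' s) ≤ |a s * a' s| := neg_le_abs _
              _ = |a s| * |a' s| := abs_mul _ _
              _ ≤ _ := by gcongr
          linarith
        have e2 : Real.exp (ρ * s) * √(N s - a s ^ 2) ≤ √(Y s) := by
          apply Real.le_sqrt_of_sq_le
          rw [mul_pow, Real.sq_sqrt (hS s hs2), ← Real.exp_nat_mul]
          simp only [hY]
          have : ((2:ℕ):ℝ) * (ρ * s) = 2 * ρ * s := by push_cast; ring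
          rw [this]
          have := sq_nonneg e
          linarith
        have e3 : Real.exp (2 * ρ * s) = Real.exp (ρ * s) * Real.exp (ρ * s) := by
          rw [← Real.exp_add]; congr 1; ring
        calc Real.exp (2 * ρ * s) * (2 * ρ * (N s - a s ^2) + (N' s - 2 * a s * a' s))
            ≤ Real.exp (2 * ρ * s) * (2 * A * (κ * √(N s - a s ^ 2))) := by gcongr
          _ = 2 * A * κ * Real.exp (ρ * s) * (Real.exp (ρ * s) * √(N s - a s ^ 2)) := by rw [e3]; ring
          _ ≤ 2 * A * κ * Real.exp (ρ * s) * √(Y s) := by gcongr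
          _ = _ := by field_simp
    have h1 := anti (show (0:ℝ) ∈ Icc 0 T from ⟨le_rfl, hT⟩) ht ht.1
    simp only [mul_zero, Real.exp_zero, mul_one] at h1
    have h2 : Real.exp (ρ * t) * √(N t - a t ^ 2) ≤ √(Y t) := by
      apply Real.le_sqrt_of_sq_le
      rw [mul_pow, Real.sq_sqrt (hS t ht1), ← Real.exp_nat_mul]
      simp only [hY]
      have : ((2:ℕ):ℝ) * (ρ * t) = 2 * ρ * t := by push_cast; ring
      rw [this]
      have := sq_nonneg e
      linarith
    have h3 : √(Y 0) ≤ 1 + e := by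
      simp only [hY, mul_zero, Real.exp_zero, one_mul]
      apply Real.sqrt_le_iff.2 ⟨by positivity, ?_⟩
      have := sq_nonneg (a 0)
      nlinarith
    have h4 : 0 ≤ κ / ρ * A := by positivity
    linarith
  have e0 : Real.exp (-ρ * t) * Real.exp (ρ * t) = 1 := by rw [← Real.exp_add]; simp
  calc √(N t - a t ^ 2) = Real.exp (-ρ * t) * (Real.exp (ρ * t) * √(N t - a t ^ 2)) := by
        rw [← mul_assoc, e0, one_mul]
    _ ≤ Real.exp (-ρ * t) * (1 + κ / ρ * A * Real.exp (ρ * t)) := by gcongr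
    _ = Real.exp (-ρ * t) + κ / ρ * A * (Real.exp (-ρ * t) * Real.exp (ρ * t)) := by ring
    _ = _ := by rw [e0, mul_one]

lemma ode_final (a a' N N' : ℝ → ℝ) (κ ρ : ℝ) (hκ : 0 < κ) (hρ : 0 < ρ) (hx : κ / ρ ≤ 1 / 2)
    (ca : ContinuousOn a (Icc 0 1)) (cN : ContinuousOn N (Icc 0 1))
    (da : ∀ t ∈ Ioo (0:ℝ) 1, HasDerivAt a (a' t) t) (dN : ∀ t ∈ Ioo (0:ℝ) 1, HasDerivAt N (N' t) t)
    (hS : ∀ t ∈ Icc (0:ℝ) 1, 0 ≤ N t - a t ^ 2)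
    (ba : ∀ t ∈ Ioo (0:ℝ) 1, |a' t| ≤ κ * √(N t - a t ^ 2))
    (bN : ∀ t ∈ Ioo (0:ℝ) 1, N' t ≤ -2 * ρ * (N t - a t ^ 2))
    (hN0 : N 0 ≤ 1) (hNanti : AntitoneOn N (Icc 0 1)) :
    ∀ t ∈ Icc (0:ℝ) 1, √(N t - a t ^ 2) ≤ Real.exp (-ρ * t) + 5 * (κ / ρ) * (|a 0| + κ / ρ) := by
  set x := κ / ρ with hxdef
  have hx0 : 0 < x := by positivity
  have hκx : κ = ρ * x := by rw [hxdef]; field_simp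
  set T : ℝ := min 1 (Real.log (1 / x) / ρ) with hT
  have hlog : 0 < Real.log (1 / x) := Real.log_pos (by rw [lt_div_iff₀ hx0]; linarith)
  have hT0 : 0 ≤ T := le_min zero_le_one (by positivity)
  have hT1 : T ≤ 1 := min_le_left _ _
  have hκT : κ * x * T ≤ 1 / 2 := by
    have h1 : T ≤ Real.log (1 / x) / ρ := min_le_right _ _
    have h2 : Real.log (1/x) ≤ 1 / x := (Real.log_le_sub_one_of_pos (by positivity)).trans (by linarith)
    calc κ * x * T ≤ κ * x * ((1 / x) / ρ) := by
          gcongr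
          exact h1.trans (by gcongr)
      _ = x := by rw [hκx]; field_simp
      _ ≤ _ := hx
  obtain ⟨tm, htm, hmax⟩ := (isCompact_Icc (a := (0:ℝ)) (b := T)).exists_isMaxOn ⟨0, le_rfl, hT0⟩
    ((ca.mono (Icc_subset_Icc_right hT1)).abs)
  set A := |a tm| with hA
  have hA0 : 0 ≤ A := abs_nonneg _
  have haA : ∀ t ∈ Icc 0 T, |a t| ≤ A := fun t ht => hmax ht
  have stA := ode_stepA a a' N N' κ ρ T A hκ hρ hT1 hA0 ca cN da dN hS ba bN hN0 haA
  have stB : ∀ σ : ℝ, |σ| = 1 → σ * a tm ≤ |a 0| + x + κ * x * A * T := by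
    intro σ hσ
    have dD : ∀ s ∈ Ioo (0:ℝ) T, HasDerivAt (fun s => σ * a s + x * Real.exp (-ρ * s) - κ * x * A * s)
        (σ * a' s + x * (Real.exp (-ρ * s) * (-ρ * 1)) - κ * x * A * 1) s := by
      intro s hs
      have h1 : HasDerivAt (fun s : ℝ => Real.exp (-ρ * s)) (Real.exp (-ρ * s) * (-ρ * 1)) s :=
        ((hasDerivAt_id s).const_mul (-ρ)).exp
      exact (((da s ⟨hs.1, hs.2.trans_le hT1⟩).const_mul σ).add (h1.const_mul x)).sub
        ((hasDerivAt_id s).const_mul _)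
    have anti : AntitoneOn (fun s => σ * a s + x * Real.exp (-ρ * s) - κ * x * A * s) (Icc 0 T) := by
      apply antitoneOn_of_deriv_nonpos (convex_Icc 0 T)
      · have := ca.mono (Icc_subset_Icc_right hT1)
        fun_prop
      · rw [interior_Icc]
        exact fun s hs => (dD s hs).differentiableAt.differentiableWithinAt
      · rw [interior_Icc]
        intro s hs
        rw [(dD s hs).deriv]
        have h1 := ba s ⟨hs.1, hs.2.trans_le hT1⟩
        have h2 := stA s ⟨hs.1.le, hs.2.le⟩
        have h3 : σ * a' s ≤ |a' s| := by
          calc σ * a' s ≤ |σ * a' s| := le_abs_self _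
            _ = _ := by rw [abs_mul, hσ, one_mul]
        have h4 : κ * √(N s - a s ^ 2) ≤ κ * (Real.exp (-ρ * s) + x * A) := by gcongr
        have h5 : κ * Real.exp (-ρ * s) = x * (Real.exp (-ρ * s) * ρ) := by rw [hκx]; ring
        nlinarith
    have h1 := anti (show (0:ℝ) ∈ Icc 0 T from ⟨le_rfl, hT0⟩) htm htm.1
    simp only [mul_zero, Real.exp_zero, mul_one, sub_zero] at h1
    have h2 : 0 < x * Real.exp (-ρ * tm) := by positivity
    have h3 : κ * x * A * tm ≤ κ * x * A * T := by gcongr; exact htm.2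
    have h4 : σ * a 0 ≤ |a 0| := by
      calc σ * a 0 ≤ |σ * a 0| := le_abs_self _
        _ = _ := by rw [abs_mul, hσ, one_mul]
    linarith
  have hAb : A ≤ 2 * (|a 0| + x) := by
    have h1 : A ≤ |a 0| + x + κ * x * A * T := by
      rcases abs_cases (a tm) with h | h
      · have := stB 1 (by simp); rw [hA, h.1]; rw [one_mul, hA, h.1] at this; exact this
      · have := stB (-1) (by simp); rw [hA, h.1]; rw [neg_one_mul, hA, h.1] at this; exact this
    have h2 : κ * x * A * T ≤ 1 / 2 * A := by
      calc κ * x * A * T = (κ * x * T) * A := by ring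
        _ ≤ _ := by gcongr
    linarith
  have ha0 := abs_nonneg (a 0)
  have hglob : ∀ t ∈ Icc (0:ℝ) 1, |a t| ≤ 5 * (|a 0| + x) := by
    intro t ht
    rcases le_total t T with h | h
    · have := haA t ⟨ht.1, h⟩
      linarith
    · rcases le_or_gt 1 (Real.log (1 / x) / ρ) with h1 | h1
      · have : T = 1 := min_eq_left h1
        have := haA t ⟨ht.1, by rw [this]; exact ht.2⟩
        linarith
      · have hTe : T = Real.log (1 / x) / ρ := min_eq_right h1.le
        have hTm : T ∈ Icc (0:ℝ) 1 := ⟨hT0, hT1⟩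
        have hexp : Real.exp (-ρ * T) = x := by
          rw [hTe]
          have : -ρ * (Real.log (1/x) / ρ) = Real.log x := by
            rw [one_div, Real.log_inv]; field_simp
          rw [this, Real.exp_log hx0]
        have h2 := stA T ⟨hT0, le_rfl⟩
        rw [hexp] at h2
        have h3 := haA T ⟨hT0, le_rfl⟩
        have h4 : N t ≤ N T := hNanti hTm ht h
        have h5 := hS t ht
        have h6 := hS T hTm
        have h7 : |a t| ^ 2 ≤ (|a T| + √(N T - a T ^ 2)) ^ 2 := by
          have e : √(N T - a T ^ 2) ^ 2 = N T - a T ^ 2 := Real.sq_sqrt h6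
          have e1 := sq_abs (a t)
          have e2 := sq_abs (a T)
          have e3 : 0 ≤ |a T| * √(N T - a T ^ 2) := by positivity
          nlinarith
        have h8 : |a t| ≤ |a T| + √(N T - a T ^ 2) := by
          apply abs_le_of_sq_le_sq' h7 (by positivity) |>.2
        have h9 : x * A ≤ 1/2 * A := by gcongr
        linarith
  have := ode_stepA a a' N N' κ ρ 1 (5 * (|a 0| + x)) hκ hρ le_rfl (by positivity) ca cN da dN hS ba bN hN0 hglob
  intro t ht
  refine (this t ht).trans (le_of_eq ?_)
  rw [← hxdef]; ring

lemma lin_le_exp (δ : ℝ) (hδ : 0 < δ) (x : ℝ) :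
    (x + 1) * Real.exp (-δ * x) ≤ (1 + 2/δ) * Real.exp (-(δ/2) * x) ∨ x < 0 := by
  by_cases hx : x < 0
  · exact Or.inr hx
  push Not at hx
  left
  have e : Real.exp (-δ * x) = Real.exp (-(δ/2) * x) * Real.exp (-(δ/2) * x) := by
    rw [← Real.exp_add]; congr 1; ring
  have e2 : Real.exp (δ/2*x) * Real.exp (-(δ/2) * x) = 1 := by rw [← Real.exp_add]; simp
  have h1 := Real.add_one_le_exp (δ/2*x)
  have h2 : x + 1 ≤ (1 + 2/δ) * Real.exp (δ/2*x) := by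
    have : x = 2/δ * (δ/2*x) := by field_simp
    have h3 : 0 ≤ δ/2*x := by positivity
    have h4 : 2/δ * (δ/2*x) ≤ 2/δ * Real.exp (δ/2*x) := by gcongr; linarith
    linarith
  rw [e, ← mul_assoc]
  gcongr
  calc _ ≤ (1 + 2/δ) * Real.exp (δ/2*x) * Real.exp (-(δ/2) * x) := by gcongr
    _ = _ := by rw [mul_assoc, e2, mul_one]

lemma intOn_of_bound (g : ℝ → ℝ) (C δ : ℝ) (hδ : 0 < δ) (cg : ContinuousOn g (Ioi 0))
    (b : ∀ x, 0 < x → |g x| ≤ C * Real.exp (-δ * x)) : IntegrableOn g (Ioi 0) := by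
  refine Integrable.mono' ((integrableOn_exp_neg δ hδ 0).const_mul C) 
    (cg.aestronglyMeasurable measurableSet_Ioi) ?_
  exact (ae_restrict_iff' measurableSet_Ioi).2 (Eventually.of_forall fun s hs => b s hs)

lemma intOn_of_bound_lin (g : ℝ → ℝ) (C δ : ℝ) (hC : 0 ≤ C) (hδ : 0 < δ) (cg : ContinuousOn g (Ioi 0))
    (b : ∀ x, 0 < x → |g x| ≤ C * ((x + 1) * Real.exp (-δ * x))) : IntegrableOn g (Ioi 0) := by
  refine intOn_of_bound g (C * (1 + 2/δ)) (δ/2) (by positivity) cg fun x hx => ?_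
  refine (b x hx).trans ?_
  rw [mul_assoc]
  refine mul_le_mul_of_nonneg_left ?_ hC
  rcases lin_le_exp δ hδ x with h | h
  · exact h
  · linarith

lemma int3 {g1 g2 g3 : ℝ → ℝ} (a b : ℝ) {S : Set ℝ} (h1 : IntegrableOn g1 S) (h2 : IntegrableOn g2 S)
    (h3 : IntegrableOn g3 S) : ∫ x in S, ((a * g1 x + b * g2 x) + g3 x) =
      (a * ∫ x in S, g1 x) + (b * ∫ x in S, g2 x) + ∫ x in S, g3 x := by
  rw [integral_add (f := fun x => a * g1 x + b * g2 x) ((h1.const_mul _).add (h2.const_mul _)) h3,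
        integral_add (h1.const_mul _) (h2.const_mul _), integral_const_mul, integral_const_mul]

lemma cauchy_int (u v : ℝ → ℝ) (hu : IntegrableOn (fun x => u x ^ 2) (Ioi 0))
    (hv : IntegrableOn (fun x => v x ^ 2) (Ioi 0))
    (huv : IntegrableOn (fun x => u x * v x) (Ioi 0)) :
    |∫ x in Ioi (0:ℝ), u x * v x| ≤ √(∫ x in Ioi (0:ℝ), v x ^ 2) * √(∫ x in Ioi (0:ℝ), u x ^ 2) := by
  have h : ∀ s : ℝ, 0 ≤ (∫ x in Ioi (0:ℝ), v x ^ 2) * (s * s) + (2 * ∫ x in Ioi (0:ℝ), u x * v x) * s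
      + ∫ x in Ioi (0:ℝ), u x ^ 2 := by
    intro s
    have e : ∫ x in Ioi (0:ℝ), (u x + s * v x)^2 = (∫ x in Ioi (0:ℝ), v x ^ 2) * (s * s) + (2 * ∫ x in Ioi (0:ℝ), u x * v x) * s
      + ∫ x in Ioi (0:ℝ), u x ^ 2 := by
      have : (fun x => (u x + s * v x)^2) = fun x => ((s*s) * v x ^ 2 + (2*s)*(u x * v x)) + u x ^ 2 := by
        ext x; ring
      rw [this, int3 _ _ hv huv hu]
      ring
    rw [← e]
    exact integral_nonneg fun x => sq_nonneg _
  have hd := discrim_le_zero h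
  unfold discrim at hd
  have hA : 0 ≤ ∫ x in Ioi (0:ℝ), v x ^ 2 := integral_nonneg fun x => sq_nonneg _
  rw [← Real.sqrt_mul hA]
  apply Real.abs_le_sqrt
  nlinarith

noncomputable def gPsi (f : ℝ → ℝ) (c r x : ℝ) : ℝ := r * (c * f (r^2*x))
noncomputable def gPsi1 (f1 : ℝ → ℝ) (c r x : ℝ) : ℝ := r * (c * (r^2 * f1 (r^2*x)))
noncomputable def gPhi0 (f f1 : ℝ → ℝ) (c y : ℝ) : ℝ := c * (f y + 2 * y * f1 y)
noncomputable def gPhi (f f1 : ℝ → ℝ) (c r x : ℝ) : ℝ := r * gPhi0 f f1 c (r^2*x)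

lemma scale_int (G H : ℝ → ℝ) (r : ℝ) (hr : 0 < r) :
    ∫ x in Ioi (0:ℝ), (r * G (r^2*x)) * (r * H (r^2*x)) = ∫ y in Ioi (0:ℝ), G y * H y := by
  have h := integral_comp_mul_left_Ioi' (fun y => G y * H y) 0 (b := r^2) (by positivity)
  simp only [mul_zero, smul_eq_mul] at h
  rw [← h, ← integral_const_mul]
  congr 1; ext x; ring

section
variable {f f1 : ℝ → ℝ} {α M γ : ℝ} 

lemma AiryData.cf (D : AiryData f f1 α M γ) : Continuous f :=
  continuous_iff_continuousAt.2 fun x => (D.d0 x).continuousAt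
lemma AiryData.cf1 (D : AiryData f f1 α M γ) : Continuous f1 :=
  continuous_iff_continuousAt.2 fun x => (D.d1 x).continuousAt

lemma AiryData.phi_bd (D : AiryData f f1 α M γ) (c y : ℝ) (hc : 0 < c) (hy : 0 ≤ y) :
    |gPhi0 f f1 c y| ≤ 10 * c * M * Real.exp (-(1/4) * y) := by
  unfold gPhi0
  have h := lin_le_exp (1/2) (by norm_num) y
  rcases h with h | h
  swap
  · linarith
  have h0 := D.b0 y hy
  have h1 := D.b1 y hy
  have hM := D.Mpos
  have e : Real.exp (-(y/2)) = Real.exp (-(1/2) * y) := by congr 1; ring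
  rw [e] at h0 h1
  rw [abs_mul, abs_of_pos hc]
  have e0 := Real.exp_pos (-(1/2) * y)
  calc c * |f y + 2 * y * f1 y| ≤ c * (|f y| + 2 * y * |f1 y|) := by
        gcongr
        refine (abs_add_le _ _).trans ?_
        rw [abs_mul, abs_of_nonneg (by positivity : 0 ≤ 2 * y)]
    _ ≤ c * (M * Real.exp (-(1/2) * y) + 2 * y * (M * Real.exp (-(1/2) * y))) := by gcongr
    _ ≤ c * (2 * M * ((y + 1) * Real.exp (-(1/2) * y))) := by
        gcongr
        nlinarith [mul_pos hM e0]
    _ ≤ c * (2 * M * ((1 + 2/(1/2)) * Real.exp (-(1/2/2) * y))) := by gcongr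
    _ = _ := by norm_num; ring

lemma AiryData.phi_int (D : AiryData f f1 α M γ) (c : ℝ) (hc : 0 < c) :
    IntegrableOn (fun y => gPhi0 f f1 c y ^ 2) (Ioi 0) := by
  have cf := D.cf
  have cf1 := D.cf1
  have hM := D.Mpos
  refine intOn_of_bound _ ((10 * c * M) * (10 * c * M)) (1/4) (by norm_num) ?_ ?_
  · unfold gPhi0; fun_prop
  · intro x hx
    have h := D.phi_bd c x hc hx.le
    have : Real.exp (-(1/4) * x) ≤ 1 := by rw [Real.exp_le_one_iff]; linarith
    rw [abs_pow, sq, mul_assoc]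
    refine mul_le_mul (h.trans ?_) h (abs_nonneg _) (by positivity)
    exact mul_le_of_le_one_right (by positivity) this

lemma AiryData.phi_orth (D : AiryData f f1 α M γ) (c : ℝ) (hc : 0 < c) :
    ∫ y in Ioi (0:ℝ), c * f y * gPhi0 f f1 c y = 0 := by
  have cf := D.cf
  have cf1 := D.cf1
  have hM := D.Mpos
  have hi : IntegrableOn (fun y => c * f y * gPhi0 f f1 c y) (Ioi 0) := by
    refine intOn_of_bound _ ((c * M) * (10 * c * M)) (1/4) (by norm_num) ?_ ?_
    · unfold gPhi0; fun_prop
    · intro x hx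
      have h := D.phi_bd c x hc hx.le
      have : Real.exp (-(x/2)) ≤ 1 := by rw [Real.exp_le_one_iff]; linarith
      rw [abs_mul, mul_assoc, abs_mul, abs_of_pos hc]
      refine mul_le_mul (mul_le_mul_of_nonneg_left ((D.b0 x hx.le).trans ?_) hc.le) h (abs_nonneg _) (by positivity)
      exact mul_le_of_le_one_right (by positivity) this
  have := integral_Ioi_of_hasDerivAt_of_tendsto' (a := 0) (m := 0) (f := fun y => c^2 * (y * f y ^ 2))
    (f' := fun y => c * f y * gPhi0 f f1 c y) ?_ hi ?_
  · simpa using this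
  · intro x _
    have := ((hasDerivAt_id x).mul ((D.d0 x).pow 2)).const_mul (c^2)
    convert! this using 1
    unfold gPhi0
    simp; ring
  · have := (tendsto_mul_exp_neg_half.const_mul (c^2 * M^2))
    rw [mul_zero] at this
    refine squeeze_zero_norm' ?_ this
    filter_upwards [eventually_gt_atTop 0] with x hx
    have h0 := D.b0 x hx.le
    have : Real.exp (-(x/2)) ≤ 1 := by rw [Real.exp_le_one_iff]; linarith
    have h1 : f x ^ 2 ≤ M * (M * Real.exp (-(x/2))) := by
      rw [← sq_abs, sq]
      refine mul_le_mul (h0.trans ?_) h0 (abs_nonneg _) hM.le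
      exact mul_le_of_le_one_right (by positivity) this
    rw [Real.norm_of_nonneg (by positivity)]
    calc c^2 * (x * f x ^ 2) ≤ c^2 * (x * (M * (M * Real.exp (-(x/2))))) := by gcongr
      _ = _ := by ring
end

section
variable {f f1 : ℝ → ℝ} {α M γ : ℝ} 

lemma AiryData.psi_d (D : AiryData f f1 α M γ) (c r x : ℝ) :
    HasDerivAt (gPsi f c r) (gPsi1 f1 c r x) x := by
  have h : HasDerivAt (fun x => r^2 * x) (r^2*1) x := (hasDerivAt_id x).const_mul _
  have := (((D.d0 (r^2*x)).comp x h).const_mul c).const_mul r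
  convert! this using 1
  unfold gPsi1; ring

lemma AiryData.psi1_d (D : AiryData f f1 α M γ) (c r x : ℝ) :
    HasDerivAt (gPsi1 f1 c r) (r^4 * (r^2 * x - α) * gPsi f c r x) x := by
  have h : HasDerivAt (fun x => r^2 * x) (r^2*1) x := (hasDerivAt_id x).const_mul _
  have := ((((D.d1 (r^2*x)).comp x h).const_mul (r^2)).const_mul c).const_mul r
  convert! this using 1
  unfold gPsi; ring

lemma AiryData.psi_b (D : AiryData f f1 α M γ) (c r x : ℝ) (hc : 0 < c) (hr : 0 < r) (hx : 0 ≤ x) :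
    |gPsi f c r x| ≤ (r * c * M) * Real.exp (-(r^2/2) * x) := by
  unfold gPsi
  have := D.b0 (r^2*x) (by positivity)
  rw [abs_mul, abs_mul, abs_of_pos hr, abs_of_pos hc, mul_assoc, mul_assoc]
  gcongr
  convert! this using 3
  ring

lemma AiryData.psi1_b (D : AiryData f f1 α M γ) (c r x : ℝ) (hc : 0 < c) (hr : 0 < r) (hx : 0 ≤ x) :
    |gPsi1 f1 c r x| ≤ (r^3 * c * M) * Real.exp (-(r^2/2) * x) := by
  unfold gPsi1
  have := D.b1 (r^2*x) (by positivity)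
  rw [abs_mul, abs_mul, abs_mul, abs_of_pos hr, abs_of_pos hc, abs_of_pos (by positivity : 0 < r^2)]
  have e : Real.exp (-(r^2/2) * x) = Real.exp (-(r^2*x/2)) := by congr 1; ring
  rw [e]
  calc r * (c * (r^2 * |f1 (r^2*x)|)) ≤ r * (c * (r^2 * (M * Real.exp (-(r^2*x/2))))) := by gcongr
    _ = _ := by ring

lemma exp_neg_le_one' (δ x : ℝ) (hδ : 0 < δ) (hx : 0 ≤ x) : Real.exp (-δ * x) ≤ 1 := by
  rw [Real.exp_le_one_iff]; nlinarith

set_option maxHeartbeats 2000000 in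
lemma AiryData.space (D : AiryData f f1 α M γ) (c r : ℝ) (hc : c = |f1 0|⁻¹) (hr : 0 < r)
    (u u1 u2 : ℝ → ℝ) (C δ : ℝ) (hC : 0 < C) (hδ : 0 < δ)
    (hu : ∀ x, 0 < x → HasDerivAt u (u1 x) x) (hu1 : ∀ x, 0 < x → HasDerivAt u1 (u2 x) x)
    (cu2 : ContinuousOn u2 (Ioi 0))
    (b0 : ∀ x, 0 < x → |u x| ≤ C * Real.exp (-δ * x))
    (b1 : ∀ x, 0 < x → |u1 x| ≤ C * Real.exp (-δ * x))
    (b2 : ∀ x, 0 < x → |u2 x| ≤ C * Real.exp (-δ * x))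
    (u0 : u 0 = 0) (bx : ∀ x, 0 < x → |u x| ≤ C * x) :
    (IntegrableOn (fun x => u x ^ 2) (Ioi 0) ∧ IntegrableOn (fun x => u x * gPsi f c r x) (Ioi 0) ∧
    IntegrableOn (fun x => (u2 x - r^4 * (r^2*x - α) * u x) * gPsi f c r x) (Ioi 0) ∧
    IntegrableOn (fun x => u x * (u2 x - r^4 * (r^2*x - α) * u x)) (Ioi 0) ∧
    IntegrableOn (fun x => u x * gPhi f f1 c r x) (Ioi 0)) ∧
    ((∫ x in Ioi (0:ℝ), (u x - (∫ y in Ioi (0:ℝ), u y * gPsi f c r y) * gPsi f c r x)^2)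
      = (∫ x in Ioi (0:ℝ), u x ^ 2) - (∫ y in Ioi (0:ℝ), u y * gPsi f c r y)^2) ∧
    (∫ x in Ioi (0:ℝ), (u2 x - r^4 * (r^2*x - α) * u x) * gPsi f c r x = 0) ∧
    (∫ x in Ioi (0:ℝ), u x * (u2 x - r^4 * (r^2*x - α) * u x)
      ≤ -(γ * r^4) * ((∫ x in Ioi (0:ℝ), u x ^ 2) - (∫ y in Ioi (0:ℝ), u y * gPsi f c r y)^2)) ∧
    |∫ x in Ioi (0:ℝ), u x * gPhi f f1 c r x| ≤ √(∫ y in Ioi (0:ℝ), gPhi0 f f1 c y ^ 2) *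
      √((∫ x in Ioi (0:ℝ), u x ^ 2) - (∫ y in Ioi (0:ℝ), u y * gPsi f c r y)^2) := by
  have hcp : 0 < c := by rw [hc]; exact inv_pos.2 (abs_pos.2 D.nz1)
  have hM := D.Mpos
  have hα := D.hα
  have hγ := D.γpos
  have cf := D.cf
  have cf1 := D.cf1
  set ψ := gPsi f c r with hψ
  set ψ1 := gPsi1 f1 c r with hψ1
  set b := ∫ y in Ioi (0:ℝ), u y * ψ y with hb
  have cψ : Continuous ψ := by rw [hψ]; unfold gPsi; fun_prop
  have cψ1 : Continuous ψ1 := by rw [hψ1]; unfold gPsi1; fun_prop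
  have cφ : Continuous (gPhi f f1 c r) := by unfold gPhi gPhi0; fun_prop
  have cu : ContinuousOn u (Ioi 0) := fun x hx => (hu x hx).continuousAt.continuousWithinAt
  have cu1 : ContinuousOn u1 (Ioi 0) := fun x hx => (hu1 x hx).continuousAt.continuousWithinAt
  -- constants
  set δ' := min δ (r^2/2) with hδ'
  have hδp : 0 < δ' := lt_min hδ (by positivity)
  have ee1 : ∀ x, 0 < x → Real.exp (-δ * x) ≤ Real.exp (-δ' * x) := fun x hx => by
    apply Real.exp_le_exp.2
    have : δ' ≤ δ := min_le_left _ _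
    nlinarith
  have ee2 : ∀ x, 0 < x → Real.exp (-(r^2/2) * x) ≤ Real.exp (-δ' * x) := fun x hx => by
    apply Real.exp_le_exp.2
    have : δ' ≤ r^2/2 := min_le_right _ _
    nlinarith
  set P := r * c * M with hP
  set P1 := r^3 * c * M with hP1
  have hPp : 0 < P := by positivity
  have hP1p : 0 < P1 := by positivity
  have pb : ∀ x, 0 < x → |ψ x| ≤ P * Real.exp (-δ' * x) := fun x hx =>
    (D.psi_b c r x hcp hr hx.le).trans (mul_le_mul_of_nonneg_left (ee2 x hx) hPp.le)
  have pb1 : ∀ x, 0 < x → |ψ1 x| ≤ P1 * Real.exp (-δ' * x) := fun x hx =>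
    (D.psi1_b c r x hcp hr hx.le).trans (mul_le_mul_of_nonneg_left (ee2 x hx) hP1p.le)
  have lone : ∀ x, 0 < x → Real.exp (-δ' * x) ≤ 1 := fun x hx => exp_neg_le_one' _ _ hδp hx.le
  have pbc : ∀ x, 0 < x → |ψ x| ≤ P := fun x hx =>
    (pb x hx).trans (mul_le_of_le_one_right hPp.le (lone x hx))
  have pbc1 : ∀ x, 0 < x → |ψ1 x| ≤ P1 := fun x hx =>
    (pb1 x hx).trans (mul_le_of_le_one_right hP1p.le (lone x hx))
  have B0 : ∀ x, 0 < x → |u x| ≤ C * Real.exp (-δ' * x) := fun x hx =>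
    (b0 x hx).trans (mul_le_mul_of_nonneg_left (ee1 x hx) hC.le)
  have B1 : ∀ x, 0 < x → |u1 x| ≤ C * Real.exp (-δ' * x) := fun x hx =>
    (b1 x hx).trans (mul_le_mul_of_nonneg_left (ee1 x hx) hC.le)
  have B2 : ∀ x, 0 < x → |u2 x| ≤ C * Real.exp (-δ' * x) := fun x hx =>
    (b2 x hx).trans (mul_le_mul_of_nonneg_left (ee1 x hx) hC.le)
  have uc : ∀ x, 0 < x → |u x| ≤ C := fun x hx =>
    (B0 x hx).trans (mul_le_of_le_one_right hC.le (lone x hx))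
  have uc1 : ∀ x, 0 < x → |u1 x| ≤ C := fun x hx =>
    (B1 x hx).trans (mul_le_of_le_one_right hC.le (lone x hx))
  -- product integrability
  have pint : ∀ (g h : ℝ → ℝ) (A B : ℝ), 0 ≤ A → ContinuousOn g (Ioi 0) → ContinuousOn h (Ioi 0) →
      (∀ x, 0 < x → |g x| ≤ A) → (∀ x, 0 < x → |h x| ≤ B * Real.exp (-δ' * x)) →
      IntegrableOn (fun x => g x * h x) (Ioi 0) := by
    intro g h A B hA cg ch bg bh
    refine intOn_of_bound _ (A * B) δ' hδp (cg.mul ch) fun x hx => ?_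
    rw [abs_mul, mul_assoc]
    exact mul_le_mul (bg x hx) (bh x hx) (abs_nonneg _) hA
  have iuψ : IntegrableOn (fun x => u x * ψ x) (Ioi 0) := pint u ψ C P hC.le cu cψ.continuousOn uc pb
  have iuu : IntegrableOn (fun x => u x ^ 2) (Ioi 0) := by
    simpa only [sq] using pint u u C C hC.le cu cu uc B0
  have iψψ : IntegrableOn (fun x => ψ x ^ 2) (Ioi 0) := by
    simpa only [sq] using pint ψ ψ P P hPp.le cψ.continuousOn cψ.continuousOn pbc pb
  have nrm : ∫ x in Ioi (0:ℝ), ψ x ^ 2 = 1 := by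
    have h := scale_int (fun y => c * f y) (fun y => c * f y) r hr
    have e : (fun y => c * f y * (c * f y)) = fun y => c^2 * f y ^ 2 := by ext y; ring
    rw [e, integral_const_mul, D.nrm] at h
    simp only [sq]
    rw [hψ]; unfold gPsi
    rw [h, hc, inv_pow, sq_abs]
    exact inv_mul_cancel₀ (pow_ne_zero _ D.nz1)
  have phib : ∀ x, 0 < x → |gPhi f f1 c r x| ≤ r * (10 * c * M) := by
    intro x hx
    unfold gPhi
    rw [abs_mul, abs_of_pos hr]
    gcongr
    refine (D.phi_bd c (r^2*x) hcp (by positivity)).trans ?_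
    exact mul_le_of_le_one_right (by positivity) (exp_neg_le_one' _ _ (by norm_num) (by positivity))
  have iφφ : IntegrableOn (fun x => gPhi f f1 c r x ^ 2) (Ioi 0) := by
    have := (integrableOn_Ioi_comp_mul_left_iff (fun y => gPhi0 f f1 c y ^ 2) 0 (a := r^2) (by positivity)).2 (by
      simpa using D.phi_int c hcp)
    have := this.const_mul (r^2)
    have e : (fun x => gPhi f f1 c r x ^ 2) = fun x => r^2 * gPhi0 f f1 c (r^2*x) ^ 2 := by
      ext x; unfold gPhi; ring
    rw [e]; exact this
  have eφφ : ∫ x in Ioi (0:ℝ), gPhi f f1 c r x ^ 2 = ∫ y in Ioi (0:ℝ), gPhi0 f f1 c y ^ 2 := by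
    have h := scale_int (gPhi0 f f1 c) (gPhi0 f f1 c) r hr
    simpa only [sq, gPhi] using h
  have eψφ : ∫ x in Ioi (0:ℝ), gPhi f f1 c r x * ψ x = 0 := by
    have h := scale_int (fun y => c * f y) (gPhi0 f f1 c) r hr
    rw [D.phi_orth c hcp] at h
    refine Eq.trans ?_ h
    congr 1; ext x
    rw [hψ]; unfold gPsi gPhi; ring
  have iφψ : IntegrableOn (fun x => gPhi f f1 c r x * ψ x) (Ioi 0) :=
    pint _ ψ _ P (by positivity) cφ.continuousOn cψ.continuousOn phib pb
  have iφu : IntegrableOn (fun x => gPhi f f1 c r x * u x) (Ioi 0) :=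
    pint _ u _ C (by positivity) cφ.continuousOn cu phib B0
  -- (i)
  have I1 : (∫ x in Ioi (0:ℝ), (u x - b * ψ x)^2) = (∫ x in Ioi (0:ℝ), u x ^ 2) - b^2 := by
    have : (fun x => (u x - b * ψ x)^2) = fun x => ((b^2) * ψ x ^ 2 + (-2*b)*(u x * ψ x)) + u x ^ 2 := by
      ext x; ring
    rw [this, int3 _ _ iψψ iuψ iuu, nrm, ← hb]
    ring
  -- (ii)
  have lx : ∀ x, 0 < x → |r^4 * (r^2*x - α)| ≤ (r^4 * (r^2 + α)) * (x + 1) := by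
    intro x hx
    rw [abs_mul, abs_of_pos (by positivity), mul_assoc]
    gcongr
    rw [abs_le]
    have : 0 < r^2 := by positivity
    constructor <;> nlinarith [mul_pos this hx, mul_pos hα hx]
  have LB : ∀ x, 0 < x → |u2 x - r^4 * (r^2*x - α) * u x| ≤ (C + r^4 * (r^2 + α) * C) * ((x + 1) * Real.exp (-δ' * x)) := by
    intro x hx
    calc _ ≤ |u2 x| + |r^4 * (r^2*x - α)| * |u x| := by
            refine (abs_sub _ _).trans ?_
            rw [abs_mul (r^4 * (r^2*x - α))]
      _ ≤ C * Real.exp (-δ' * x) + ((r^4 * (r^2 + α)) * (x + 1)) * (C * Real.exp (-δ' * x)) := by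
            gcongr
            · exact B2 x hx
            · exact lx x hx
            · exact B0 x hx
      _ ≤ _ := by
            have := Real.exp_pos (-δ' * x)
            nlinarith [mul_pos (mul_pos hC this) hx]
  have cL : ContinuousOn (fun x => u2 x - r^4 * (r^2*x - α) * u x) (Ioi 0) := by fun_prop
  have iL : ∀ (g : ℝ → ℝ) (A : ℝ), 0 ≤ A → ContinuousOn g (Ioi 0) → (∀ x, 0 < x → |g x| ≤ A) →
      IntegrableOn (fun x => g x * (u2 x - r^4 * (r^2*x - α) * u x)) (Ioi 0) := by
    intro g A hA cg bg
    refine intOn_of_bound_lin _ (A * (C + r^4 * (r^2 + α) * C)) δ' (by positivity) hδp (cg.mul cL) fun x hx => ?_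
    rw [abs_mul, mul_assoc A]
    exact mul_le_mul (bg x hx) (LB x hx) (abs_nonneg _) hA
  have iψL := iL ψ P hPp.le cψ.continuousOn pbc
  have iuL := iL u C hC.le cu uc
  have ψ0 : ψ 0 = 0 := by rw [hψ]; unfold gPsi; simp [D.z]
  have I2 : ∫ x in Ioi (0:ℝ), ψ x * (u2 x - r^4 * (r^2*x - α) * u x) = 0 := by
    have := integral_Ioi_of_hasDerivAt_of_tendsto (a := 0) (m := 0) (f := fun x => ψ x * u1 x - ψ1 x * u x)
      (f' := fun x => ψ x * (u2 x - r^4 * (r^2*x - α) * u x)) ?_ ?_ iψL ?_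
    · simpa [ψ0, u0] using this
    · rw [← continuousWithinAt_sdiff_self]
      simp only [Ici_sdiff_left]
      have : Tendsto (fun x => |ψ x| * C + P1 * (C * x)) (𝓝[>] 0) (𝓝 0) := by
        have h : Continuous (fun x => |ψ x| * C + P1 * (C * x)) := by fun_prop
        have h2 := h.tendsto 0
        simp only [ψ0, abs_zero, zero_mul, mul_zero, add_zero] at h2
        exact h2.mono_left nhdsWithin_le_nhds
      unfold ContinuousWithinAt
      simp only [ψ0, u0, zero_mul, mul_zero, sub_zero]
      refine squeeze_zero_norm' ?_ this
      filter_upwards [self_mem_nhdsWithin] with x hx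
      refine (norm_sub_le _ _).trans ?_
      rw [norm_mul, norm_mul]
      simp only [Real.norm_eq_abs]
      gcongr
      · exact uc1 x hx
      · exact pbc1 x hx
      · exact bx x hx
    · intro x hx
      have := ((D.psi_d c r x).mul (hu1 x hx)).sub ((D.psi1_d c r x).mul (hu x hx))
      convert! this using 1
      simp only [hψ]; ring
    · have := (tendsto_lin_exp δ' hδp).const_mul (P * C + P1 * C)
      rw [mul_zero] at this
      refine squeeze_zero_norm' ?_ this
      filter_upwards [eventually_gt_atTop 0] with x hx
      refine (norm_sub_le _ _).trans ?_
      rw [norm_mul, norm_mul]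
      simp only [Real.norm_eq_abs]
      have e0 := Real.exp_pos (-δ' * x)
      calc _ ≤ P * (C * Real.exp (-δ' * x)) + P1 * (C * Real.exp (-δ' * x)) := by
              gcongr
              · exact pbc x hx
              · exact B1 x hx
              · exact pbc1 x hx
              · exact B0 x hx
        _ = (P * C + P1 * C) * (1 * Real.exp (-δ' * x)) := by ring
        _ ≤ _ := by gcongr; linarith
  refine ⟨⟨iuu, iuψ, ?_, iuL, ?_⟩, I1, ?_, ?_, ?_⟩
  · have e : (fun x => (u2 x - r^4 * (r^2*x - α) * u x) * ψ x) = fun x => ψ x * (u2 x - r^4 * (r^2*x - α) * u x) := by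
      ext x; ring
    rw [e]; exact iψL
  · have e : (fun x => u x * gPhi f f1 c r x) = fun x => gPhi f f1 c r x * u x := by ext x; ring
    rw [e]; exact iφu
  · refine Eq.trans ?_ I2
    congr 1; ext x; ring
  · -- gap
    have orth : ∫ x in Ioi (0:ℝ), ψ x * (u x - b * ψ x) = 0 := by
      have : (fun x => ψ x * (u x - b * ψ x)) = fun x => ((-b) * ψ x ^ 2 + 0 * (u x * ψ x)) + u x * ψ x := by
        ext x; ring
      rw [this, int3 _ _ iψψ iuψ iuψ, nrm, ← hb]; ring
    have ed : (fun x => (u x - b * ψ x) * ((u2 x - b * (r^4 * (r^2*x - α) * ψ x)) - r^4 * (r^2*x - α) * (u x - b * ψ x)))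
        = fun x => (-b * (ψ x * (u2 x - r^4 * (r^2*x - α) * u x)) + 0 * (u x * ψ x)) + u x * (u2 x - r^4 * (r^2*x - α) * u x) := by
      ext x; ring
    have hint : IntegrableOn (fun x => (u x - b * ψ x) * ((u2 x - b * (r^4 * (r^2*x - α) * ψ x)) - r^4 * (r^2*x - α) * (u x - b * ψ x))) (Ioi 0) := by
      rw [ed]
      exact ((iψL.const_mul _).add (iuψ.const_mul _)).add iuL
    set X := (1 + α)/r^2 with hX
    have hXp : 0 < X := by positivity
    have hXi : ∀ x, X ≤ x → 1 + α ≤ r^2 * x := fun x hx => by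
      rw [hX, div_le_iff₀ (by positivity)] at hx; linarith
    set MM := P + P1 + r^2 * (r^2 + 2) with hMM
    have hbx : ∀ x, 0 < x → |ψ x| ≤ P1 * x := by
      intro x hx
      have h := (convex_Icc (0:ℝ) x).norm_image_sub_le_of_norm_hasDerivWithin_le (f := ψ) (f' := ψ1) (C := P1) (x := 0) (y := x)
        (fun y _ => (D.psi_d c r y).hasDerivWithinAt) (fun y hy => by
          refine (D.psi1_b c r y hcp hr hy.1).trans ?_
          exact mul_le_of_le_one_right hP1p.le (exp_neg_le_one' _ _ (by positivity) hy.1))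
        ⟨le_rfl, hx.le⟩ ⟨hx.le, le_rfl⟩
      simpa [ψ0, abs_of_pos hx] using h
    have G := gap_lemma ψ ψ1 (fun x => r^4 * (r^2*x - α)) (fun x => u x - b * ψ x) (fun x => u1 x - b * ψ1 x)
      (fun x => u2 x - b * (r^4 * (r^2*x - α) * ψ x)) (γ * r^4) MM (C + |b| * P + |b| * P1) δ' X (by positivity)
      (by positivity) (by positivity) hδp hXp (D.psi_d c r) (D.psi1_d c r) ψ0
      (fun x hx => by
        rw [hψ]; unfold gPsi
        have := D.nz (r^2*x) (by positivity)
        positivity)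
      (by
        rw [hψ1]; unfold gPsi1
        have := D.nz1
        simp only [mul_zero]
        positivity)
      (fun x hx => by
        refine (D.psi_b c r x hcp hr hx).trans ((mul_le_of_le_one_right hPp.le (exp_neg_le_one' _ _ (by positivity) hx)).trans ?_)
        have : 0 < r^2 * (r^2 + 2) := by positivity
        linarith)
      (fun x hx => by
        refine (D.psi1_b c r x hcp hr hx).trans ((mul_le_of_le_one_right hP1p.le (exp_neg_le_one' _ _ (by positivity) hx)).trans ?_)
        have : 0 < r^2 * (r^2 + 2) := by positivity
        linarith)
      (fun x hx => by
        have h := D.gap (r^2*x) (by positivity)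
        have h2 := mul_le_mul_of_nonneg_left h (by positivity : 0 ≤ r^4 * (r*c)^2)
        simp only [hψ, hψ1, gPsi, gPsi1]
        nlinarith [h2])
      (fun x hx => by
        have h := D.lin (r^2*x) (hXi x hx)
        have hx0 : 0 < x := hXp.trans_le hx
        have hr2 : 0 < r^2 := by positivity
        simp only [hψ, hψ1, gPsi, gPsi1, abs_mul, abs_of_pos hr, abs_of_pos hcp, abs_of_pos hr2]
        have k1 : r^2 * (r^2*x + 2) ≤ MM * (x+1) := by
          calc r^2 * (r^2*x + 2) ≤ r^2 * ((r^2 + 2) * (x+1)) := by gcongr; nlinarith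
            _ = (r^2 * (r^2 + 2)) * (x+1) := by ring
            _ ≤ MM * (x+1) := by gcongr; rw [hMM]; linarith
        calc r * (c * (r^2 * |f1 (r^2*x)|)) ≤ r * (c * (r^2 * ((r^2*x+2) * |f (r^2*x)|))) := by gcongr
          _ = (r^2 * (r^2*x+2)) * (r * (c * |f (r^2*x)|)) := by ring
          _ ≤ _ := by gcongr)
      (fun x y hx hxy => by
        have h := D.anti (r^2*x) (r^2*y) (hXi x hx) (by gcongr)
        simp only [hψ, gPsi, abs_mul, abs_of_pos hr, abs_of_pos hcp]
        gcongr)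
      (fun x hx => (hu x hx).sub ((D.psi_d c r x).const_mul b))
      (fun x hx => (hu1 x hx).sub ((D.psi1_d c r x).const_mul b))
      (fun x hx => by
        refine (abs_sub _ _).trans ?_
        rw [abs_mul]
        have e0 := Real.exp_pos (-δ' * x)
        have h1 := mul_le_mul_of_nonneg_left (pb x hx) (abs_nonneg b)
        have h2 := B0 x hx
        have h3 : 0 ≤ |b| * P1 * Real.exp (-δ' * x) := by positivity
        nlinarith)
      (fun x hx => by
        refine (abs_sub _ _).trans ?_
        rw [abs_mul]
        have h1 := mul_le_mul_of_nonneg_left (hbx x hx) (abs_nonneg b)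
        have h2 := bx x hx
        have h3 : 0 ≤ |b| * P * x := by positivity
        nlinarith)
      (fun x hx => by
        refine (abs_sub _ _).trans ?_
        rw [abs_mul]
        have h1 := mul_le_mul_of_nonneg_left (pbc1 x hx) (abs_nonneg b)
        have h2 := uc1 x hx
        have h3 : 0 ≤ |b| * P := by positivity
        nlinarith)
      orth hint
    rw [I1] at G
    refine le_trans (le_of_eq ?_) G
    rw [ed, int3 _ _ iψL iuψ iuL, I2]
    ring
  · rw [← eφφ, ← I1]
    have iR : IntegrableOn (fun x => (u x - b * ψ x)^2) (Ioi 0) := by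
      have : (fun x => (u x - b * ψ x)^2) = fun x => ((b^2) * ψ x ^ 2 + (-2*b)*(u x * ψ x)) + u x ^ 2 := by
        ext x; ring
      rw [this]
      exact ((iψψ.const_mul _).add (iuψ.const_mul _)).add iuu
    have e : (fun x => (u x - b * ψ x) * gPhi f f1 c r x) = fun x => (-b * (gPhi f f1 c r x * ψ x) + 0 * (gPhi f f1 c r x * ψ x)) + gPhi f f1 c r x * u x := by
      ext x; ring
    have h := cauchy_int (fun x => u x - b * ψ x) (gPhi f f1 c r) iR iφφ (by
      rw [e]
      exact ((iφψ.const_mul _).add (iφψ.const_mul _)).add iφu)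
    rw [e, int3 _ _ iφψ iφψ iφu, eψφ] at h
    simp only [mul_zero, zero_add] at h
    have e2 : (fun x => u x * gPhi f f1 c r x) = fun x => gPhi f f1 c r x * u x := by ext x; ring
    rw [e2]; exact h
end

lemma diff_int (F F' : ℝ → ℝ → ℝ) (B B' δ : ℝ) (hB : 0 ≤ B) (hB' : 0 ≤ B') (hδ : 0 < δ)
    (cF : ∀ t ∈ Icc (0:ℝ) 1, ContinuousOn (F t) (Ioi 0))
    (bF : ∀ t ∈ Icc (0:ℝ) 1, ∀ x, 0 < x → |F t x| ≤ B * ((x+1) * Real.exp (-δ * x)))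
    (cFt : ∀ x, 0 < x → ContinuousOn (fun t => F t x) (Icc 0 1))
    (cF' : ∀ t ∈ Ioo (0:ℝ) 1, ContinuousOn (F' t) (Ioi 0))
    (bF' : ∀ t ∈ Ioo (0:ℝ) 1, ∀ x, 0 < x → |F' t x| ≤ B' * ((x+1) * Real.exp (-δ * x)))
    (dF : ∀ t ∈ Ioo (0:ℝ) 1, ∀ x, 0 < x → HasDerivAt (fun s => F s x) (F' t x) t) :
    ContinuousOn (fun t => ∫ x in Ioi (0:ℝ), F t x) (Icc 0 1) ∧
    ∀ t ∈ Ioo (0:ℝ) 1, HasDerivAt (fun t => ∫ x in Ioi (0:ℝ), F t x) (∫ x in Ioi (0:ℝ), F' t x) t := by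
  have ib : ∀ B : ℝ, 0 ≤ B → IntegrableOn (fun x => B * ((x+1) * Real.exp (-δ * x))) (Ioi 0) := by
    intro B hB
    refine intOn_of_bound_lin _ B δ hB hδ (by fun_prop) fun x hx => ?_
    rw [abs_of_nonneg]
    positivity
  constructor
  · refine continuousOn_of_dominated (bound := fun x => B * ((x+1) * Real.exp (-δ * x))) ?_ ?_ (ib B hB) ?_
    · exact fun t ht => (cF t ht).aestronglyMeasurable measurableSet_Ioi
    · exact fun t ht => (ae_restrict_iff' measurableSet_Ioi).2 (Eventually.of_forall fun s hs => bF t ht s hs)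
    · exact (ae_restrict_iff' measurableSet_Ioi).2 (Eventually.of_forall fun s hs => cFt s hs)
  · intro t ht
    refine (hasDerivAt_integral_of_dominated_loc_of_deriv_le (bound := fun x => B' * ((x+1) * Real.exp (-δ * x)))
      (s := Ioo 0 1) (Ioo_mem_nhds ht.1 ht.2) ?_ ?_ ?_ ?_ (ib B' hB') ?_).2
    · filter_upwards [Ioo_mem_nhds ht.1 ht.2] with s hs
      exact (cF s ⟨hs.1.le, hs.2.le⟩).aestronglyMeasurable measurableSet_Ioi
    · have ht' : t ∈ Icc (0:ℝ) 1 := ⟨ht.1.le, ht.2.le⟩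
      exact intOn_of_bound_lin _ B δ hB hδ (cF t ht') (bF t ht')
    · exact (cF' t ht).aestronglyMeasurable measurableSet_Ioi
    · exact (ae_restrict_iff' measurableSet_Ioi).2 (Eventually.of_forall fun x hx s hs => bF' s hs x hx)
    · exact (ae_restrict_iff' measurableSet_Ioi).2 (Eventually.of_forall fun x hx s hs => dF s hs x hx)

section
variable {f f1 : ℝ → ℝ} {α M γ : ℝ} 

lemma AiryData.psi_dr (D : AiryData f f1 α M γ) (c : ℝ) (r : ℝ → ℝ) (r' t x : ℝ) (hr : HasDerivAt r r' t)
    (hrt : 0 < r t) :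
    HasDerivAt (fun s => gPsi f c (r s) x) (r' / r t * gPhi f f1 c (r t) x) t := by
  have h : HasDerivAt (fun s => r s^2 * x) _ t := (hr.pow 2).mul_const x
  have := hr.mul (((D.d0 (r t^2*x)).comp t h).const_mul c)
  convert! this using 1
  unfold gPhi gPhi0
  simp
  field_simp

set_option maxHeartbeats 2000000 in
lemma AiryData.core (D : AiryData f f1 α M γ) (c ε : ℝ) (hc : c = |f1 0|⁻¹) (hε : 0 < ε)
    (r r' E : ℝ → ℝ) (w w1 w2 : ℝ → ℝ → ℝ) (C δ L κ ρ : ℝ) (hC : 0 < C) (hδ : 0 < δ)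
    (hκ : 0 < κ) (hρ : 0 < ρ) (hL : 0 ≤ L)
    (hr : ∀ t ∈ Icc (0:ℝ) 1, 0 < r t) (cr : ContinuousOn r (Icc 0 1))
    (dr : ∀ t ∈ Ioo (0:ℝ) 1, HasDerivAt r (r' t) t)
    (hL' : ∀ t ∈ Ioo (0:ℝ) 1, |r' t / r t| ≤ L)
    (hLκ : L * √(∫ y in Ioi (0:ℝ), gPhi0 f f1 c y ^ 2) ≤ κ)
    (hρ' : ∀ t ∈ Ioo (0:ℝ) 1, ρ ≤ ε⁻¹ * γ * r t ^ 4)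
    (E0 : E 0 = 1) (Epos : ∀ t, 0 < E t) (cE : ContinuousOn E (Icc 0 1))
    (dE : ∀ t ∈ Ioo (0:ℝ) 1, HasDerivAt E (E t * (ε⁻¹ * α * r t ^ 4)) t)
    (hw : ∀ t ∈ Icc (0:ℝ) 1, ∀ x, 0 < x → HasDerivAt (w t) (w1 t x) x)
    (hw1 : ∀ t ∈ Icc (0:ℝ) 1, ∀ x, 0 < x → HasDerivAt (w1 t) (w2 t x) x)
    (cw2 : ∀ t ∈ Icc (0:ℝ) 1, ContinuousOn (w2 t) (Ioi 0))
    (cwt : ∀ x, 0 < x → ContinuousOn (fun t => w t x) (Icc 0 1))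
    (b0 : ∀ t ∈ Icc (0:ℝ) 1, ∀ x, 0 < x → |w t x| ≤ C * Real.exp (-δ * x))
    (b1 : ∀ t ∈ Icc (0:ℝ) 1, ∀ x, 0 < x → |w1 t x| ≤ C * Real.exp (-δ * x))
    (b2 : ∀ t ∈ Icc (0:ℝ) 1, ∀ x, 0 < x → |w2 t x| ≤ C * Real.exp (-δ * x))
    (w0 : ∀ t ∈ Icc (0:ℝ) 1, w t 0 = 0) (bx : ∀ t ∈ Icc (0:ℝ) 1, ∀ x, 0 < x → |w t x| ≤ C * x)
    (pde : ∀ t ∈ Ioo (0:ℝ) 1, ∀ x, 0 < x →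
      HasDerivAt (fun s => w s x) (ε⁻¹ * (w2 t x - r t ^ 6 * x * w t x)) t)
    (hN : ∫ x in Ioi (0:ℝ), w 0 x ^ 2 ≤ 1) :
    ∀ t ∈ Icc (0:ℝ) 1,
      √(∫ x in Ioi (0:ℝ), (E t * w t x - (∫ y in Ioi (0:ℝ), E t * w t y * gPsi f c (r t) y) * gPsi f c (r t) x)^2) ≤ 1 ∧
      (κ / ρ ≤ 1/2 →
      √(∫ x in Ioi (0:ℝ), (E t * w t x - (∫ y in Ioi (0:ℝ), E t * w t y * gPsi f c (r t) y) * gPsi f c (r t) x)^2)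
        ≤ Real.exp (-ρ * t) + 5 * (κ / ρ) * (|∫ x in Ioi (0:ℝ), w 0 x * gPsi f c (r 0) x| + κ / ρ)) := by
  have hcp : 0 < c := by rw [hc]; exact inv_pos.2 (abs_pos.2 D.nz1)
  have hM := D.Mpos
  have hα := D.hα
  have hγ := D.γpos
  have cf := D.cf
  have cf1 := D.cf1
  have oi : ∀ t ∈ Ioo (0:ℝ) 1, t ∈ Icc (0:ℝ) 1 := fun t ht => ⟨ht.1.le, ht.2.le⟩
  have sp := fun t ht => D.space c (r t) hc (hr t ht) (w t) (w1 t) (w2 t) C δ hC hδ (hw t ht) (hw1 t ht) (cw2 t ht)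
    (b0 t ht) (b1 t ht) (b2 t ht) (w0 t ht) (bx t ht)
  obtain ⟨R, hR⟩ := (isCompact_Icc (a := (0:ℝ)) (b := 1)).exists_bound_of_continuousOn cr
  have hR : ∀ t ∈ Icc (0:ℝ) 1, r t ≤ R := fun t ht => (le_abs_self _).trans (hR t ht)
  have hRp : 0 < R := (hr 0 ⟨le_rfl, zero_le_one⟩).trans_le (hR 0 ⟨le_rfl, zero_le_one⟩)
  have cw : ∀ t ∈ Icc (0:ℝ) 1, ContinuousOn (w t) (Ioi 0) := fun t ht x hx =>
    (hw t ht x hx).continuousAt.continuousWithinAt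
  have ex1 : ∀ x : ℝ, 0 < x → Real.exp (-δ * x) ≤ (x+1) * Real.exp (-δ * x) := fun x hx =>
    le_mul_of_one_le_left (Real.exp_pos _).le (by linarith)
  have wc : ∀ t ∈ Icc (0:ℝ) 1, ∀ x, 0 < x → |w t x| ≤ C := fun t ht x hx =>
    (b0 t ht x hx).trans (mul_le_of_le_one_right hC.le (exp_neg_le_one' _ _ hδ hx.le))
  have wl : ∀ t ∈ Icc (0:ℝ) 1, ∀ x, 0 < x → |w t x| ≤ C * ((x+1) * Real.exp (-δ * x)) := fun t ht x hx =>
    (b0 t ht x hx).trans (mul_le_mul_of_nonneg_left (ex1 x hx) hC.le)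
  set T := ε⁻¹ * (C + R^6 * C) with hT
  have hTp : 0 < T := by positivity
  have wtl : ∀ t ∈ Icc (0:ℝ) 1, ∀ x, 0 < x → |ε⁻¹ * (w2 t x - r t ^ 6 * x * w t x)| ≤ T * ((x+1) * Real.exp (-δ * x)) := by
    intro t ht x hx
    have hrt := hr t ht
    rw [abs_mul, abs_of_pos (inv_pos.2 hε), hT, mul_assoc ε⁻¹]
    refine mul_le_mul_of_nonneg_left ?_ (inv_pos.2 hε).le
    refine (abs_sub _ _).trans ?_
    rw [abs_mul, abs_of_pos (by positivity : 0 < r t ^ 6 * x), add_mul]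
    have h1 : |w2 t x| ≤ C * ((x+1) * Real.exp (-δ * x)) :=
      (b2 t ht x hx).trans (mul_le_mul_of_nonneg_left (ex1 x hx) hC.le)
    have h2 : r t ^ 6 * x * |w t x| ≤ R^6 * (x+1) * (C * Real.exp (-δ * x)) := by
      gcongr
      · exact hR t ht
      · linarith
      · exact b0 t ht x hx
    refine add_le_add h1 (h2.trans (le_of_eq (by ring)))
  set P := R * c * M with hP
  have hPp : 0 < P := by positivity
  have ψb : ∀ t ∈ Icc (0:ℝ) 1, ∀ x, 0 < x → |gPsi f c (r t) x| ≤ P := by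
    intro t ht x hx
    have hrt := hr t ht
    refine (D.psi_b c (r t) x hcp (hr t ht) hx.le).trans ?_
    refine (mul_le_of_le_one_right (by positivity) (exp_neg_le_one' _ _ (by positivity) hx.le)).trans ?_
    rw [hP]; gcongr; exact hR t ht
  set P2 := R * (10 * c * M) with hP2
  have hP2p : 0 < P2 := by positivity
  have φb : ∀ t ∈ Icc (0:ℝ) 1, ∀ x, 0 < x → |gPhi f f1 c (r t) x| ≤ P2 := by
    intro t ht x hx
    have hrt := hr t ht
    unfold gPhi
    rw [abs_mul, abs_of_pos hrt]
    rw [hP2]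
    gcongr
    · exact hR t ht
    refine (D.phi_bd c (r t^2*x) hcp (by positivity)).trans ?_
    exact mul_le_of_le_one_right (by positivity) (exp_neg_le_one' _ _ (by norm_num) (by positivity))
  have cψ : ∀ r, Continuous (gPsi f c r) := by intro r; unfold gPsi; fun_prop
  have cφ : ∀ r, Continuous (gPhi f f1 c r) := by intro r; unfold gPhi gPhi0; fun_prop
  have cψt : ∀ x, ContinuousOn (fun t => gPsi f c (r t) x) (Icc 0 1) := by
    intro x; unfold gPsi
    have : ContinuousOn (fun t => f (r t ^ 2 * x)) (Icc 0 1) := cf.comp_continuousOn (by fun_prop)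
    fun_prop
  -- N_w
  obtain ⟨cNw, dNw⟩ := diff_int (fun t x => w t x ^ 2)
    (fun t x => 2 * w t x * (ε⁻¹ * (w2 t x - r t ^ 6 * x * w t x))) (C * C) (2 * C * T) δ (by positivity) (by positivity) hδ
    (fun t ht => (cw t ht).pow 2)
    (fun t ht x hx => by
      rw [sq, abs_mul, mul_assoc]
      exact mul_le_mul (wc t ht x hx) (wl t ht x hx) (abs_nonneg _) hC.le)
    (fun x hx => (cwt x hx).pow 2)
    (fun t ht => by
      have := cw t (oi t ht)
      have := cw2 t (oi t ht)
      fun_prop)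
    (fun t ht x hx => by
      rw [abs_mul, abs_mul, abs_two, mul_assoc (2 * C)]
      have := wc t (oi t ht) x hx
      exact mul_le_mul (by gcongr) (wtl t (oi t ht) x hx) (abs_nonneg _) (by positivity))
    (fun t ht x hx => by
      have := (pde t ht x hx).pow 2
      convert! this using 1
      simp)
  obtain ⟨cb, db⟩ := diff_int (fun t x => w t x * gPsi f c (r t) x)
    (fun t x => (ε⁻¹ * (w2 t x - r t ^ 6 * x * w t x)) * gPsi f c (r t) x + w t x * (r' t / r t * gPhi f f1 c (r t) x))
      (P * C) (P * T + L * P2 * C) δ (by positivity) (by positivity) hδ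
    (fun t ht => (cw t ht).mul (cψ _).continuousOn)
    (fun t ht x hx => by
      rw [mul_comm, abs_mul, mul_assoc]
      exact mul_le_mul (ψb t ht x hx) (wl t ht x hx) (abs_nonneg _) hPp.le)
    (fun x hx => (cwt x hx).mul (cψt x))
    (fun t ht => by
      have := cw t (oi t ht)
      have := cw2 t (oi t ht)
      have := cψ (r t)
      have := cφ (r t)
      fun_prop)
    (fun t ht x hx => by
      refine (abs_add_le _ _).trans ?_
      rw [add_mul]
      refine add_le_add ?_ ?_
      · rw [mul_comm, abs_mul, mul_assoc P]
        exact mul_le_mul (ψb t (oi t ht) x hx) (wtl t (oi t ht) x hx) (abs_nonneg _) hPp.le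
      · rw [mul_comm, abs_mul, abs_mul, mul_assoc (L * P2)]
        exact mul_le_mul (mul_le_mul (hL' t ht) (φb t (oi t ht) x hx) (abs_nonneg _) hL) (wl t (oi t ht) x hx) (abs_nonneg _) (by positivity))
    (fun t ht x hx => (pde t ht x hx).mul (D.psi_dr c r (r' t) t x (dr t ht) (hr t (oi t ht))))
  set Nw : ℝ → ℝ := fun t => ∫ x in Ioi (0:ℝ), w t x ^ 2 with hNw
  set b : ℝ → ℝ := fun t => ∫ x in Ioi (0:ℝ), w t x * gPsi f c (r t) x with hb
  set IL : ℝ → ℝ := fun t => ∫ x in Ioi (0:ℝ), w t x * (w2 t x - r t^4 * (r t^2*x - α) * w t x) with hIL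
  set IF : ℝ → ℝ := fun t => ∫ x in Ioi (0:ℝ), w t x * gPhi f f1 c (r t) x with hIF
  have eN : ∀ t ∈ Ioo (0:ℝ) 1, (∫ x in Ioi (0:ℝ), 2 * w t x * (ε⁻¹ * (w2 t x - r t ^ 6 * x * w t x)))
      = 2 * ε⁻¹ * IL t - 2 * ε⁻¹ * α * r t ^ 4 * Nw t := by
    intro t ht
    obtain ⟨⟨i1, i2, i3, i4, i5⟩, -⟩ := sp t (oi t ht)
    have e : (fun x => 2 * w t x * (ε⁻¹ * (w2 t x - r t ^ 6 * x * w t x))) = fun x =>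
      ((2 * ε⁻¹ * (w t x * (w2 t x - r t^4 * (r t^2*x - α) * w t x)) + (-(2 * ε⁻¹ * α * r t ^ 4) - 1) * w t x ^ 2) + w t x ^ 2) := by
      ext x; ring
    rw [e, int3 _ _ i4 i1 i1]
    simp only [hIL, hNw]; ring
  have eb : ∀ t ∈ Ioo (0:ℝ) 1, (∫ x in Ioi (0:ℝ), ((ε⁻¹ * (w2 t x - r t ^ 6 * x * w t x)) * gPsi f c (r t) x + w t x * (r' t / r t * gPhi f f1 c (r t) x)))
      = r' t / r t * IF t - ε⁻¹ * α * r t ^ 4 * b t := by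
    intro t ht
    obtain ⟨⟨i1, i2, i3, i4, i5⟩, -, h0, -⟩ := sp t (oi t ht)
    have e : (fun x => (ε⁻¹ * (w2 t x - r t ^ 6 * x * w t x)) * gPsi f c (r t) x + w t x * (r' t / r t * gPhi f f1 c (r t) x)) = fun x =>
      ((ε⁻¹ * ((w2 t x - r t^4 * (r t^2*x - α) * w t x) * gPsi f c (r t) x) + r' t / r t * (w t x * gPhi f f1 c (r t) x)) + (-(ε⁻¹ * α * r t ^ 4)) * (w t x * gPsi f c (r t) x)) := by
      ext x; ring
    rw [e, int3 _ _ i3 i5 (i2.const_mul _), h0, integral_const_mul]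
    simp only [hIF, hb]; ring
  set N : ℝ → ℝ := fun t => E t ^ 2 * Nw t with hNdef
  set a : ℝ → ℝ := fun t => E t * b t with hadef
  have cN : ContinuousOn N (Icc 0 1) := (cE.pow 2).mul cNw
  have ca : ContinuousOn a (Icc 0 1) := cE.mul cb
  have dN : ∀ t ∈ Ioo (0:ℝ) 1, HasDerivAt N (2 * ε⁻¹ * E t ^ 2 * IL t) t := by
    intro t ht
    have := ((dE t ht).pow 2).mul (dNw t ht)
    convert! this using 1
    rw [eN t ht]
    simp only [Pi.pow_apply]
    push_cast
    ring
  have da : ∀ t ∈ Ioo (0:ℝ) 1, HasDerivAt a (E t * (r' t / r t * IF t)) t := by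
    intro t ht
    have := (dE t ht).mul (db t ht)
    convert! this using 1
    rw [eb t ht]
    ring
  have eS : ∀ t, N t - a t ^ 2 = E t ^ 2 * (Nw t - b t ^ 2) := by
    intro t; simp only [hNdef, hadef]; ring
  have eW : ∀ t ∈ Icc (0:ℝ) 1, (∫ x in Ioi (0:ℝ), (E t * w t x - (∫ y in Ioi (0:ℝ), E t * w t y * gPsi f c (r t) y) * gPsi f c (r t) x)^2) = N t - a t ^ 2 := by
    intro t ht
    obtain ⟨-, h1, -⟩ := sp t ht
    rw [eS, ← h1, ← integral_const_mul]
    have : (∫ y in Ioi (0:ℝ), E t * w t y * gPsi f c (r t) y) = E t * b t := by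
      simp only [mul_assoc, hb, integral_const_mul]
    rw [this]
    congr 1; ext x
    simp only [hb]
    ring
  have hS : ∀ t ∈ Icc (0:ℝ) 1, 0 ≤ N t - a t ^ 2 := by
    intro t ht
    rw [← eW t ht]
    exact integral_nonneg fun x => sq_nonneg _
  have bN : ∀ t ∈ Ioo (0:ℝ) 1, 2 * ε⁻¹ * E t ^ 2 * IL t ≤ -2 * ρ * (N t - a t ^ 2) := by
    intro t ht
    obtain ⟨-, -, -, h3, -⟩ := sp t (oi t ht)
    have hSt := hS t (oi t ht)
    have h4 : IL t ≤ -(γ * r t ^ 4) * (Nw t - b t ^ 2) := h3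
    have hE := Epos t
    calc 2 * ε⁻¹ * E t ^ 2 * IL t ≤ 2 * ε⁻¹ * E t ^ 2 * (-(γ * r t ^ 4) * (Nw t - b t ^ 2)) := by gcongr
      _ = - (2 * (ε⁻¹ * γ * r t ^ 4 * (N t - a t ^ 2))) := by rw [eS]; ring
      _ ≤ - (2 * (ρ * (N t - a t ^ 2))) := by
          have := mul_le_mul_of_nonneg_right (hρ' t ht) hSt
          linarith
      _ = _ := by ring
  have ba : ∀ t ∈ Ioo (0:ℝ) 1, |E t * (r' t / r t * IF t)| ≤ κ * √(N t - a t ^ 2) := by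
    intro t ht
    obtain ⟨-, -, -, -, h4⟩ := sp t (oi t ht)
    have h4 : |IF t| ≤ √(∫ y in Ioi (0:ℝ), gPhi0 f f1 c y ^ 2) * √(Nw t - b t ^ 2) := h4
    have hE := Epos t
    rw [eS, Real.sqrt_mul (by positivity), Real.sqrt_sq hE.le, abs_mul, abs_mul, abs_of_pos hE]
    calc E t * (|r' t / r t| * |IF t|) ≤ E t * (L * (√(∫ y in Ioi (0:ℝ), gPhi0 f f1 c y ^ 2) * √(Nw t - b t ^ 2))) := by
          gcongr
          exact hL' t ht
      _ = (L * √(∫ y in Ioi (0:ℝ), gPhi0 f f1 c y ^ 2)) * (E t * √(Nw t - b t ^ 2)) := by ring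
      _ ≤ _ := by gcongr
  have anti : AntitoneOn N (Icc 0 1) := by
    apply antitoneOn_of_deriv_nonpos (convex_Icc 0 1) cN
    · rw [interior_Icc]
      exact fun s hs => (dN s hs).differentiableAt.differentiableWithinAt
    · rw [interior_Icc]
      intro s hs
      rw [(dN s hs).deriv]
      have := mul_nonneg hρ.le (hS s (oi s hs))
      have := bN s hs
      linarith
  have hN0 : N 0 ≤ 1 := by
    simp only [hNdef, E0, one_pow, one_mul, hNw]; exact hN
  have ha0 : a 0 = ∫ x in Ioi (0:ℝ), w 0 x * gPsi f c (r 0) x := by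
    simp only [hadef, E0, one_mul, hb]
  intro t ht
  rw [eW t ht, ← ha0]
  constructor
  · rw [Real.sqrt_le_left (by norm_num), one_pow]
    have := anti ⟨le_rfl, zero_le_one⟩ ht ht.1
    nlinarith [sq_nonneg (a t)]
  · intro hx
    exact ode_final a _ N _ κ ρ hκ hρ hx ca cN da dN hS ba bN hN0 anti t ht
end

lemma Qone_facts (q : ℝ → ℝ) (hq : ContDiffOn ℝ 1 q (Set.Icc 0 1)) (hp : ∀ t ∈ Set.Icc (0:ℝ) 1, 0 < q t) :
    0 < Qone q ∧ ∀ t ∈ Icc (0:ℝ) 1, Qone q ≤ q t ^ ((2:ℝ)/3) := by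
  have cq := hq.continuousOn
  have c2 : ContinuousOn (fun t => q t ^ ((2:ℝ)/3)) (Icc 0 1) :=
    cq.rpow_const fun t ht => Or.inl (hp t ht).ne'
  have hc : IsCompact ((fun t => q t ^ ((2:ℝ)/3)) '' Set.Icc (0:ℝ) 1) := isCompact_Icc.image_of_continuousOn c2
  have hne : ((fun t => q t ^ ((2:ℝ)/3)) '' Set.Icc (0:ℝ) 1).Nonempty := ⟨_, mem_image_of_mem _ ⟨le_rfl, zero_le_one⟩⟩
  constructor
  · obtain ⟨t, ht, e⟩ := hc.sInf_mem hne
    unfold Qone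
    rw [← e]
    exact Real.rpow_pos_of_pos (hp t ht) _
  · intro t ht
    exact csInf_le hc.bddBelow (mem_image_of_mem _ ht)

lemma Qtwo_facts (q : ℝ → ℝ) (hq : ContDiffOn ℝ 1 q (Set.Icc 0 1)) (hp : ∀ t ∈ Set.Icc (0:ℝ) 1, 0 < q t) :
    0 ≤ Qtwo q ∧ ∀ t ∈ Ioo (0:ℝ) 1, |deriv q t / q t| ≤ Qtwo q := by
  have cq := hq.continuousOn
  have cd := hq.continuousOn_derivWithin (uniqueDiffOn_Icc zero_lt_one) le_rfl
  obtain ⟨B, hB⟩ := isCompact_Icc.exists_bound_of_continuousOn (cd.div cq fun t ht => (hp t ht).ne')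
  have bd : BddAbove ((fun t => |deriv q t / q t|) '' Set.Icc (0:ℝ) 1) := by
    refine ⟨max B (max |deriv q 0 / q 0| |deriv q 1 / q 1|), ?_⟩
    rintro _ ⟨t, ht, rfl⟩
    rcases eq_or_ne t 0 with rfl | h0
    · exact (le_max_left _ _).trans (le_max_right _ _)
    rcases eq_or_ne t 1 with rfl | h1
    · exact (le_max_right _ _).trans (le_max_right _ _)
    have := hB t ht
    rw [Pi.div_apply, derivWithin_of_mem_nhds (Icc_mem_nhds (lt_of_le_of_ne ht.1 h0.symm) (lt_of_le_of_ne ht.2 h1))] at this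
    exact this.trans (le_max_left _ _)
  have h : ∀ t ∈ Icc (0:ℝ) 1, |deriv q t / q t| ≤ Qtwo q := fun t ht => le_csSup bd (mem_image_of_mem (fun t => |deriv q t / q t|) ht)
  exact ⟨(abs_nonneg _).trans (h 0 ⟨le_rfl, zero_le_one⟩), fun t ht => h t ⟨ht.1.le, ht.2.le⟩⟩

lemma rpow_sixth (a : ℝ) (ha : 0 < a) : (a ^ ((1:ℝ)/6)) ^ 2 = a ^ ((1:ℝ)/3) ∧ (a ^ ((1:ℝ)/6)) ^ 4 = a ^ ((2:ℝ)/3) ∧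
    (a ^ ((1:ℝ)/6)) ^ 6 = a := by
  refine ⟨?_, ?_, ?_⟩ <;> rw [← Real.rpow_natCast, ← Real.rpow_mul ha.le] <;> norm_num

lemma E_facts (k : ℝ) (g : ℝ → ℝ) (cg : ContinuousOn g (Icc 0 1)) :
    ContinuousOn (fun t => Real.exp (k * ∫ s in (0:ℝ)..t, g s)) (Icc 0 1) ∧
    ∀ t ∈ Ioo (0:ℝ) 1, HasDerivAt (fun t => Real.exp (k * ∫ s in (0:ℝ)..t, g s))
      (Real.exp (k * ∫ s in (0:ℝ)..t, g s) * (k * g t)) t := by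
  constructor
  · have h := intervalIntegral.continuousOn_primitive_interval (a := (0:ℝ)) (b := 1) (f := g) (μ := volume)
      (by rw [uIcc_of_le zero_le_one]; exact cg.integrableOn_Icc)
    rw [uIcc_of_le zero_le_one] at h
    fun_prop
  · intro t ht
    have h := intervalIntegral.integral_hasDerivAt_right (f := g) (a := 0) (b := t)
      (by
        apply ContinuousOn.intervalIntegrable
        rw [uIcc_of_le ht.1.le]
        exact cg.mono (Icc_subset_Icc_right ht.2.le))
      ((cg.mono Ioo_subset_Icc_self).stronglyMeasurableAtFilter isOpen_Ioo t ht)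
      (cg.continuousAt (Icc_mem_nhds ht.1 ht.2))
    exact (h.const_mul k).exp

set_option maxHeartbeats 1000000 in
lemma main_thm
    (α₁ : ℝ) (hα₁ : 0 < α₁) (hzero : Ai (-α₁) = 0)
    (hlargest : ∀ x : ℝ, -α₁ < x → Ai x ≠ 0) :
    ∃ C : ℝ, 0 < C ∧ ∃ C₁ : ℝ, 0 < C₁ ∧
      ∀ (ε : ℝ), 0 < ε →
      ∀ (q : ℝ → ℝ), ContDiffOn ℝ 1 q (Set.Icc 0 1) →
        (∀ t ∈ Set.Icc (0:ℝ) 1, 0 < q t) →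
      ∀ (w : ℝ → ℝ → ℝ),
        ContDiffOn ℝ (⊤ : ℕ∞) (fun p : ℝ × ℝ => w p.1 p.2) (Set.Icc 0 1 ×ˢ Set.Ici 0) →
        (∃ δ : ℝ, 0 < δ ∧ ∀ t ∈ Set.Icc (0:ℝ) 1, ∀ x ∈ Set.Ici (0:ℝ),
          |w t x| + |deriv (w t) x| + |deriv (deriv (w t)) x| ≤ δ⁻¹ * Real.exp (-δ * x)) →
        (∀ t ∈ Set.Icc (0:ℝ) 1, ∀ x ∈ Set.Ici (0:ℝ),
          deriv (fun s => w s x) t = ε⁻¹ * (deriv (deriv (w t)) x - q t * x * w t x)) →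
        (∀ t ∈ Set.Icc (0:ℝ) 1, w t 0 = 0) →
        (∫ x in Set.Ioi (0:ℝ), (w 0 x) ^ 2) ≤ 1 →
      ∀ t ∈ Set.Icc (0:ℝ) 1,
        Real.sqrt (∫ x in Set.Ioi (0:ℝ),
            (Wfun α₁ ε q w t x
              - (∫ y in Set.Ioi (0:ℝ), Wfun α₁ ε q w t y * psiOne α₁ (q t) y)
                  * psiOne α₁ (q t) x) ^ 2)
          ≤ C * ((Qtwo q + 1) / Qone q) * ε
                * (((Qtwo q + 1) / Qone q) * ε
                    + |∫ x in Set.Ioi (0:ℝ), w 0 x * psiOne α₁ (q 0) x|)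
              + Real.exp (-C₁ * ε⁻¹ * Qone q * t) := by
  obtain ⟨M, γ, D⟩ := airyData α₁ hα₁ hzero hlargest
  set f : ℝ → ℝ := fun x => Ai (x - α₁) with hf
  set f1 : ℝ → ℝ := fun x => Ai1 (x - α₁) with hf1
  set c := |f1 0|⁻¹ with hc
  set K := √(∫ y in Ioi (0:ℝ), gPhi0 f f1 c y ^ 2) with hK
  have hK0 : 0 ≤ K := Real.sqrt_nonneg _
  have hγ := D.γpos
  set k0 := (K + 1) / γ with hk0
  have hk0p : 0 < k0 := by positivity
  refine ⟨5 * (k0 + k0^2), by positivity, γ, hγ, ?_⟩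
  intro ε hε q hq hp w hw ⟨δ, hδ, hbd⟩ hpde hbc hN t ht
  obtain ⟨hQ1, hQ1'⟩ := Qone_facts q hq hp
  obtain ⟨hQ2, hQ2'⟩ := Qtwo_facts q hq hp
  have cq := hq.continuousOn
  have oi : ∀ t ∈ Ioo (0:ℝ) 1, t ∈ Icc (0:ℝ) 1 := fun t ht => ⟨ht.1.le, ht.2.le⟩
  set r : ℝ → ℝ := fun t => q t ^ ((1:ℝ)/6) with hr
  have hrp : ∀ t ∈ Icc (0:ℝ) 1, 0 < r t := fun t ht => Real.rpow_pos_of_pos (hp t ht) _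
  have epsi : ∀ t ∈ Icc (0:ℝ) 1, ∀ x, psiOne α₁ (q t) x = gPsi f c (r t) x := by
    intro t ht x
    unfold psiOne gPsi
    rw [(hasDerivAt_Ai (-α₁)).deriv]
    simp only [hr, (rpow_sixth _ (hp t ht)).1, hf, hc, hf1, zero_sub]
    ring
  have cr : ContinuousOn r (Icc 0 1) := cq.rpow_const fun t ht => Or.inl (hp t ht).ne'
  have dr : ∀ t ∈ Ioo (0:ℝ) 1, HasDerivAt r (r t * (deriv q t / q t / 6)) t := by
    intro t ht
    have hq0 := hp t (oi t ht)
    have h1 : HasDerivAt q (deriv q t) t :=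
      ((hq.contDiffAt (Icc_mem_nhds ht.1 ht.2)).differentiableAt (by norm_num)).hasDerivAt
    have := h1.rpow_const (p := (1:ℝ)/6) (Or.inl hq0.ne')
    convert! this using 1
    simp only [hr]
    rw [Real.rpow_sub_one hq0.ne']
    ring
  obtain ⟨cE, dE⟩ := E_facts (ε⁻¹ * α₁) (fun s => q s ^ ((2:ℝ)/3)) (cq.rpow_const fun t ht => Or.inl (hp t ht).ne')
  -- regularity of w
  have sm : ∀ t ∈ Icc (0:ℝ) 1, ContDiffOn ℝ (⊤ : ℕ∞) (w t) (Ici 0) := by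
    intro t ht
    have h : ContDiffOn ℝ (⊤ : ℕ∞) (fun x : ℝ => (t, x)) (Ici 0) := by fun_prop
    exact hw.comp h fun x hx => ⟨ht, hx⟩
  have smo : ∀ t ∈ Icc (0:ℝ) 1, ContDiffOn ℝ (⊤ : ℕ∞) (w t) (Ioi 0) := fun t ht =>
    (sm t ht).mono Ioi_subset_Ici_self
  have smo1 : ∀ t ∈ Icc (0:ℝ) 1, ContDiffOn ℝ (⊤ : ℕ∞) (deriv (w t)) (Ioi 0) := fun t ht =>
    (smo t ht).deriv_of_isOpen isOpen_Ioi (by norm_num)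
  have smo2 : ∀ t ∈ Icc (0:ℝ) 1, ContDiffOn ℝ (⊤ : ℕ∞) (deriv (deriv (w t))) (Ioi 0) := fun t ht =>
    (smo1 t ht).deriv_of_isOpen isOpen_Ioi (by norm_num)
  have dw : ∀ t ∈ Icc (0:ℝ) 1, ∀ x, 0 < x → HasDerivAt (w t) (deriv (w t) x) x := fun t ht x hx =>
    (((smo t ht).contDiffAt (Ioi_mem_nhds hx)).differentiableAt (by norm_num)).hasDerivAt
  have dw1 : ∀ t ∈ Icc (0:ℝ) 1, ∀ x, 0 < x → HasDerivAt (deriv (w t)) (deriv (deriv (w t)) x) x := fun t ht x hx =>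
    (((smo1 t ht).contDiffAt (Ioi_mem_nhds hx)).differentiableAt (by norm_num)).hasDerivAt
  have cwt : ∀ x, 0 < x → ContinuousOn (fun t => w t x) (Icc 0 1) := by
    intro x hx
    have h : ContinuousOn (fun t : ℝ => (t, x)) (Icc 0 1) := by fun_prop
    exact hw.continuousOn.comp h fun t ht => ⟨ht, hx.le⟩
  have hC : 0 < δ⁻¹ := inv_pos.2 hδ
  have b0 : ∀ t ∈ Icc (0:ℝ) 1, ∀ x, 0 < x → |w t x| ≤ δ⁻¹ * Real.exp (-δ * x) := fun t ht x hx => by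
    have h := hbd t ht x (le_of_lt hx)
    have h1 := abs_nonneg (w t x)
    have h2 := abs_nonneg (deriv (w t) x)
    have h3 := abs_nonneg (deriv (deriv (w t)) x)
    linarith
  have b1 : ∀ t ∈ Icc (0:ℝ) 1, ∀ x, 0 < x → |deriv (w t) x| ≤ δ⁻¹ * Real.exp (-δ * x) := fun t ht x hx => by
    have h := hbd t ht x (le_of_lt hx)
    have h1 := abs_nonneg (w t x)
    have h2 := abs_nonneg (deriv (w t) x)
    have h3 := abs_nonneg (deriv (deriv (w t)) x)
    linarith
  have b2 : ∀ t ∈ Icc (0:ℝ) 1, ∀ x, 0 < x → |deriv (deriv (w t)) x| ≤ δ⁻¹ * Real.exp (-δ * x) := fun t ht x hx => by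
    have h := hbd t ht x (le_of_lt hx)
    have h1 := abs_nonneg (w t x)
    have h2 := abs_nonneg (deriv (w t) x)
    have h3 := abs_nonneg (deriv (deriv (w t)) x)
    linarith
  have bx : ∀ t ∈ Icc (0:ℝ) 1, ∀ x, 0 < x → |w t x| ≤ δ⁻¹ * x := by
    intro t ht x hx
    obtain ⟨y, hy, e⟩ := exists_hasDerivAt_eq_slope (w t) (deriv (w t)) hx
      ((sm t ht).continuousOn.mono Icc_subset_Ici_self) (fun y hy => dw t ht y hy.1)
    rw [hbc t ht, sub_zero, sub_zero] at e
    have e2 : w t x = deriv (w t) y * x := by rw [e]; field_simp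
    rw [e2, abs_mul, abs_of_pos hx]
    gcongr
    exact (b1 t ht y hy.1).trans (mul_le_of_le_one_right hC.le (exp_neg_le_one' _ _ hδ hy.1.le))
  have pde : ∀ t ∈ Ioo (0:ℝ) 1, ∀ x, 0 < x →
      HasDerivAt (fun s => w s x) (ε⁻¹ * (deriv (deriv (w t)) x - r t ^ 6 * x * w t x)) t := by
    intro t ht x hx
    have h1 : ContDiffAt ℝ (⊤ : ℕ∞) (fun p : ℝ × ℝ => w p.1 p.2) (t, x) :=
      hw.contDiffAt (prod_mem_nhds (Icc_mem_nhds ht.1 ht.2) (Ici_mem_nhds hx))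
    have h2 : ContDiffAt ℝ (⊤ : ℕ∞) (fun s : ℝ => (s, x)) t := by fun_prop
    have h3 : ContDiffAt ℝ (⊤ : ℕ∞) (fun s : ℝ => w s x) t :=
      ContDiffAt.comp (g := fun p : ℝ × ℝ => w p.1 p.2) (f := fun s : ℝ => (s, x)) t h1 h2
    have h4 := (h3.differentiableAt (by norm_num)).hasDerivAt
    rw [hpde t (oi t ht) x (le_of_lt hx)] at h4
    have h5 : r t ^ 6 = q t := (rpow_sixth _ (hp t (oi t ht))).2.2
    rw [h5]
    exact h4
  have key := D.core c ε hc hε r (fun t => r t * (deriv q t / q t / 6))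
    (fun t => Real.exp (ε⁻¹ * α₁ * ∫ s in (0:ℝ)..t, q s ^ ((2:ℝ)/3))) w (fun t => deriv (w t)) (fun t => deriv (deriv (w t)))
    δ⁻¹ δ (Qtwo q) ((K + 1) * (Qtwo q + 1)) (ε⁻¹ * γ * Qone q) hC hδ (by positivity) (by positivity) hQ2 hrp cr dr
    (fun t ht => by
      have h := hQ2' t ht
      have h0 := (hrp t (oi t ht)).ne'
      rw [mul_div_cancel_left₀ _ h0, abs_div, abs_of_pos (by norm_num : (0:ℝ) < 6)]
      have := abs_nonneg (deriv q t / q t)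
      linarith)
    (by
      rw [← hK]
      nlinarith [mul_nonneg hK0 hQ2])
    (fun t ht => by
      have h : r t ^ 4 = q t ^ ((2:ℝ)/3) := (rpow_sixth _ (hp t (oi t ht))).2.1
      rw [h]
      have := hQ1' t (oi t ht)
      gcongr)
    (by simp) (fun t => Real.exp_pos _) cE
    (fun t ht => by
      have h : r t ^ 4 = q t ^ ((2:ℝ)/3) := (rpow_sixth _ (hp t (oi t ht))).2.1
      rw [h]
      exact dE t ht)
    dw dw1 (fun t ht => (smo2 t ht).continuousOn) cwt b0 b1 b2 hbc bx pde hN t ht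
  have h01 : (0:ℝ) ∈ Icc (0:ℝ) 1 := ⟨le_rfl, zero_le_one⟩
  unfold Wfun
  simp only [epsi t ht, epsi 0 h01]
  obtain ⟨k1, k2⟩ := key
  set lam := (Qtwo q + 1) / Qone q * ε with hlam
  have hlamp : 0 < lam := by positivity
  have eκ : (K + 1) * (Qtwo q + 1) / (ε⁻¹ * γ * Qone q) = k0 * lam := by
    rw [hk0, hlam]; field_simp
  rw [eκ] at k2
  set A := |∫ x in Ioi (0:ℝ), w 0 x * gPsi f c (r 0) x| with hA
  have hA0 : 0 ≤ A := abs_nonneg _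
  have eC : 5 * (k0 + k0^2) * ((Qtwo q + 1) / Qone q) * ε * (lam + A) = 5 * (k0 + k0^2) * lam * (lam + A) := by
    rw [hlam]; ring
  have ee : -γ * ε⁻¹ * Qone q * t = -(ε⁻¹ * γ * Qone q) * t := by ring
  rw [eC, ee]
  have e0 := Real.exp_pos (-(ε⁻¹ * γ * Qone q) * t)
  have hx0 : 0 < k0 * lam := by positivity
  by_cases hx : k0 * lam ≤ 1/2
  · refine (k2 hx).trans ?_
    have h1 : 5 * (k0 * lam) * (A + k0 * lam) ≤ 5 * (k0 + k0^2) * lam * (lam + A) := by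
      have h2 : 0 ≤ k0 * lam * lam := by positivity
      have h3 : 0 ≤ k0^2 * lam * A := by positivity
      nlinarith
    linarith
  · push Not at hx
    refine k1.trans ?_
    have h2 : 0 ≤ k0 * lam * lam := by positivity
    have h3 : 0 ≤ (k0 + k0^2) * lam * A := by positivity
    nlinarith

/-- There are numerical constants `C, C₁ > 0`, independent of `ε`, `q` and `w`, such that if
`w` solves `∂ₜw = ε⁻¹(∂ₓ²w − q(t)·x·w)` on `[0,1]×[0,∞)` with Dirichlet boundary condition at
`0` and `‖w(0,·)‖_{L²(0,∞)} ≤ 1`, then for every `t ∈ [0,1]`, the component of `W_t`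
orthogonal to `ψ₁^{q(t)}` satisfies
`‖W_t − ⟨W_t, ψ₁^{q(t)}⟩·ψ₁^{q(t)}‖_{L²(0,∞)}
  ≤ C·((Q₂+1)/Q₁)·ε·(((Q₂+1)/Q₁)·ε + |⟨W_0, ψ₁^{q(0)}⟩|) + exp(−C₁·ε⁻¹·Q₁·t)`. -/
theorem renormalized_solution_higher_modes_decay
    (α₁ : ℝ) (hα₁ : 0 < α₁) (hzero : Ai (-α₁) = 0)
    (hlargest : ∀ x : ℝ, -α₁ < x → Ai x ≠ 0) :
    ∃ C : ℝ, 0 < C ∧ ∃ C₁ : ℝ, 0 < C₁ ∧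
      ∀ (ε : ℝ), 0 < ε →
      ∀ (q : ℝ → ℝ), ContDiffOn ℝ 1 q (Set.Icc 0 1) →
        (∀ t ∈ Set.Icc (0:ℝ) 1, 0 < q t) →
      ∀ (w : ℝ → ℝ → ℝ),
        ContDiffOn ℝ (⊤ : ℕ∞) (fun p : ℝ × ℝ => w p.1 p.2) (Set.Icc 0 1 ×ˢ Set.Ici 0) →
        (∃ δ : ℝ, 0 < δ ∧ ∀ t ∈ Set.Icc (0:ℝ) 1, ∀ x ∈ Set.Ici (0:ℝ),
          |w t x| + |deriv (w t) x| + |deriv (deriv (w t)) x| ≤ δ⁻¹ * Real.exp (-δ * x)) →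
        (∀ t ∈ Set.Icc (0:ℝ) 1, ∀ x ∈ Set.Ici (0:ℝ),
          deriv (fun s => w s x) t = ε⁻¹ * (deriv (deriv (w t)) x - q t * x * w t x)) →
        (∀ t ∈ Set.Icc (0:ℝ) 1, w t 0 = 0) →
        (∫ x in Set.Ioi (0:ℝ), (w 0 x) ^ 2) ≤ 1 →
      ∀ t ∈ Set.Icc (0:ℝ) 1,
        Real.sqrt (∫ x in Set.Ioi (0:ℝ),
            (Wfun α₁ ε q w t x
              - (∫ y in Set.Ioi (0:ℝ), Wfun α₁ ε q w t y * psiOne α₁ (q t) y)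
                  * psiOne α₁ (q t) x) ^ 2)
          ≤ C * ((Qtwo q + 1) / Qone q) * ε
                * (((Qtwo q + 1) / Qone q) * ε
                    + |∫ x in Set.Ioi (0:ℝ), w 0 x * psiOne α₁ (q 0) x|)
              + Real.exp (-C₁ * ε⁻¹ * Qone q * t) := by
  exact main_thm α₁ hα₁ hzero hlargest
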